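/- arXiv:1512.02364 — 7 statements merged into one kernel-verified Lean document; each statement's English description precedes it below -/
import Mathlib

section
/- Let $c \ge 0$ and $n > c$ be real numbers. For every $x > 0$, the derivative of the Shannon entropy satisfies $H'_{n,c}(x) = n\left(\log\frac{1+cx}{x} + \sum_{k=0}^\infty p_{n+c,k}^{[c]}(x)\,\log\frac{k+1}{n+ck}\right)$. -/
/-- Generalized binomial coefficient `α(α-1)⋯(α-k+1)/k!`. -/
noncomputable def genBinom (α : ℝ) (k : ℕ) : ℝ :=
  (∏ i ∈ Finset.range k, (α - i)) / (Nat.factorial k)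

/-- The basic probabilities `p_{n,k}^{[c]}(x)` for `c ≥ 0`. -/
noncomputable def pc (c n : ℝ) (k : ℕ) (x : ℝ) : ℝ :=
  if c = 0 then (n * x) ^ k / (Nat.factorial k) * Real.exp (-(n * x))
  else (-1 : ℝ) ^ k * genBinom (-n / c) k * (c * x) ^ k
    * (1 + c * x) ^ (-n / c - (k : ℝ))

/-- The Shannon entropy `H_{n,c}` (with the convention `0 log 0 = 0`). -/
noncomputable def Hent (c n : ℝ) (x : ℝ) : ℝ :=
  -∑' k : ℕ, pc c n k x * Real.log (pc c n k x)

/-- The coefficient `n (n + c) ⋯ (n + (k - 1) c) / k!` of `p_{n,k}^{[c]}`. -/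
noncomputable def risingCoeff (c n : ℝ) (k : ℕ) : ℝ :=
  (∏ i ∈ Finset.range k, (n + c * i)) / (Nat.factorial k)

/-- The probability `p_{n,0}^{[c]}(x)`. -/
noncomputable def pcZero (c n x : ℝ) : ℝ :=
  if c = 0 then Real.exp (-(n * x)) else (1 + c * x) ^ (-n / c)

lemma risingCoeff_succ (c n : ℝ) (k : ℕ) :
    ((k : ℝ) + 1) * risingCoeff c n (k + 1) = (n + c * k) * risingCoeff c n k := by
  unfold risingCoeff
  rw [Finset.prod_range_succ, Nat.factorial_succ]
  push_cast
  have : (Nat.factorial k : ℝ) ≠ 0 := by positivity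
  field_simp

lemma risingCoeff_pos {c n : ℝ} (hc : 0 ≤ c) (hn : 0 < n) (k : ℕ) : 0 < risingCoeff c n k := by
  unfold risingCoeff
  have : 0 < ∏ i ∈ Finset.range k, (n + c * i) := Finset.prod_pos fun i _ => by positivity
  positivity

lemma risingCoeff_add (c n : ℝ) (k : ℕ) :
    n * risingCoeff c (n + c) k = (n + c * k) * risingCoeff c n k := by
  have h : n * ∏ i ∈ Finset.range k, (n + c + c * i)
      = (n + c * k) * ∏ i ∈ Finset.range k, (n + c * i) := by
    rw [mul_comm (n + c * k), ← Finset.prod_range_succ (fun i : ℕ => n + c * (i : ℝ)),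
      Finset.prod_range_succ']
    push_cast
    rw [mul_zero, add_zero, mul_comm]
    congr 1
    exact Finset.prod_congr rfl fun i _ => by ring
  unfold risingCoeff
  rw [← mul_div_assoc, h, mul_div_assoc]

lemma pc_eq_risingCoeff {c : ℝ} (hc : 0 ≤ c) (n : ℝ) (k : ℕ) {x : ℝ} (hx : 0 ≤ x) :
    pc c n k x = risingCoeff c n k * (x / (1 + c * x)) ^ k * pcZero c n x := by
  unfold pc pcZero
  split_ifs with h
  · subst h
    simp only [risingCoeff, zero_mul, add_zero, Finset.prod_const, Finset.card_range, div_one]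
    ring
  · have hpos : 0 < 1 + c * x := by positivity
    have hb : (-1 : ℝ) ^ k * genBinom (-n / c) k * c ^ k = risingCoeff c n k := by
      have hprod : (-1 : ℝ) ^ k * (∏ i ∈ Finset.range k, (-n / c - i)) * c ^ k
          = ∏ i ∈ Finset.range k, (n + c * i) := by
        induction k with
        | zero => simp
        | succ k ih =>
          rw [Finset.prod_range_succ, Finset.prod_range_succ, ← ih]
          field_simp
          ring
      unfold genBinom risingCoeff
      rw [← hprod]
      ring
    rw [Real.rpow_sub hpos, Real.rpow_natCast, mul_pow, div_pow, ← hb]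
    ring

lemma pcZero_pos {c : ℝ} (hc : 0 ≤ c) (n : ℝ) {x : ℝ} (hx : 0 ≤ x) : 0 < pcZero c n x := by
  unfold pcZero
  split_ifs <;> positivity

lemma pcZero_add {c : ℝ} (hc : 0 ≤ c) (n : ℝ) {x : ℝ} (hx : 0 ≤ x) :
    pcZero c (n + c) x = pcZero c n x / (1 + c * x) := by
  unfold pcZero
  split_ifs with h
  · simp [h]
  · have hpos : 0 < 1 + c * x := by positivity
    rw [show -(n + c) / c = -n / c - 1 by field_simp; ring, Real.rpow_sub hpos, Real.rpow_one]

lemma hasDerivAt_pcZero {c : ℝ} (hc : 0 ≤ c) (n : ℝ) {x : ℝ} (hx : 0 ≤ x) :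
    HasDerivAt (pcZero c n) (-n * pcZero c n x / (1 + c * x)) x := by
  by_cases h : c = 0
  · subst h
    have h1 : pcZero 0 n = fun y => Real.exp (-(n * y)) := by
      ext y
      simp [pcZero]
    rw [h1]
    refine (((hasDerivAt_id x).const_mul n).fun_neg).exp.congr_deriv ?_
    simp
    ring
  · have h1 : pcZero c n = fun y => (1 + c * y) ^ (-n / c) := by
      ext y
      simp [pcZero, h]
    have hpos : 0 < 1 + c * x := by positivity
    rw [h1]
    refine ((((hasDerivAt_id x).const_mul c).const_add 1).rpow_const (p := -n / c)
      (Or.inl hpos.ne')).congr_deriv ?_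
    simp only [id, mul_one]
    rw [Real.rpow_sub hpos, Real.rpow_one]
    field_simp

lemma hasDerivAt_div_one_add_mul {c x : ℝ} (h : 1 + c * x ≠ 0) :
    HasDerivAt (fun y => y / (1 + c * y)) (1 / (1 + c * x) ^ 2) x := by
  refine ((hasDerivAt_id x).fun_div (((hasDerivAt_id x).const_mul c).const_add 1) h).congr_deriv ?_
  simp only [id, one_mul, mul_one]
  ring

lemma abs_log_risingCoeff_le {c n : ℝ} (hc : 0 ≤ c) (hn : 0 < n) (k : ℕ) :
    |Real.log (risingCoeff c n k)| ≤ (n + c + 1 / n) * (k : ℝ) ^ 2 := by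
  induction k with
  | zero => simp [risingCoeff]
  | succ k ih =>
    have hk : (0 : ℝ) < k + 1 := by positivity
    have hr : 0 < n + c * k := by positivity
    have hq : risingCoeff c n (k + 1) = (n + c * k) / (k + 1) * risingCoeff c n k := by
      have := risingCoeff_succ c n k
      field_simp
      linarith
    have hup : Real.log ((n + c * k) / (k + 1)) ≤ n + c := by
      refine (Real.log_le_self (by positivity)).trans ?_
      rw [div_le_iff₀ hk]
      have : 0 ≤ n * k := by positivity
      nlinarith
    have hlow : -Real.log ((n + c * k) / (k + 1)) ≤ 1 / n * (k + 1) := by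
      rw [← Real.log_inv, inv_div]
      refine (Real.log_le_self (by positivity)).trans ?_
      rw [div_le_iff₀ hr]
      have : 0 ≤ 1 / n * (k + 1) * (c * k) := by positivity
      have h2 : 1 / n * (k + 1) * n = k + 1 := by field_simp
      nlinarith
    have hstep : |Real.log ((n + c * k) / (k + 1))| ≤ (n + c + 1 / n) * (k + 1) := by
      have h1 : 0 ≤ 1 / n * ((k : ℝ) + 1) := by positivity
      have h2 : 0 ≤ (n + c) * (k : ℝ) := by positivity
      have h3 : 0 ≤ n + c := by positivity
      rw [abs_le]
      constructor <;> nlinarith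
    rw [hq, Real.log_mul (by positivity) (risingCoeff_pos hc hn k).ne']
    refine (abs_add_le _ _).trans ?_
    have hK : 0 ≤ (n + c + 1 / n) * (k : ℝ) := by positivity
    push_cast
    nlinarith

lemma summable_risingCoeff {c n : ℝ} (hc : 0 ≤ c) (hn : 0 < n) {s : ℝ} (hs : 0 < s)
    (hcs : c * s < 1) :
    Summable fun k : ℕ => ((k : ℝ) + 1) ^ 3 * risingCoeff c n k * s ^ k := by
  have hpos : ∀ k : ℕ, 0 < ((k : ℝ) + 1) ^ 3 * risingCoeff c n k * s ^ k := fun k => by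
    have := risingCoeff_pos hc hn k
    positivity
  refine summable_of_ratio_test_tendsto_lt_one (l := c * s) hcs
    (Filter.Eventually.of_forall fun k => (hpos k).ne') ?_
  have hu : Filter.Tendsto (fun k : ℕ => 1 / ((k : ℝ) + 1)) Filter.atTop (nhds 0) :=
    tendsto_one_div_add_atTop_nhds_zero_nat
  have hlim : Filter.Tendsto (fun k : ℕ => (1 + 1 / ((k : ℝ) + 1)) ^ 3
      * (c + (n - c) * (1 / ((k : ℝ) + 1))) * s) Filter.atTop (nhds (c * s)) := by
    have := (((hu.const_add 1).pow 3).mul ((hu.const_mul (n - c)).const_add c)).mul_const s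
    simpa using this
  refine hlim.congr fun k => ?_
  rw [Real.norm_of_nonneg (hpos _).le, Real.norm_of_nonneg (hpos _).le]
  have hb := risingCoeff_pos hc hn k
  have hk : (0 : ℝ) < k + 1 := by positivity
  have hq : risingCoeff c n (k + 1) = (n + c * k) / (k + 1) * risingCoeff c n k := by
    have := risingCoeff_succ c n k
    field_simp
    linarith
  rw [hq]
  push_cast
  field_simp
  ring

lemma hasSum_of_forall_eq {f g : ℕ → ℝ} {a : ℝ} (h : HasSum f a) (hfg : ∀ k, g k = f k) :
    HasSum g a :=
  (funext hfg : g = f) ▸ h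

lemma exists_gt_mul_lt_one {c t : ℝ} (hc : 0 ≤ c) (hct : c * t < 1) : ∃ s, t < s ∧ c * s < 1 := by
  refine ⟨t + (1 - c * t) / (c + 1), ?_, ?_⟩
  · have : 0 < (1 - c * t) / (c + 1) := div_pos (by linarith) (by linarith)
    linarith
  · rw [mul_add, ← lt_sub_iff_add_lt', ← mul_div_assoc, div_lt_iff₀ (by linarith)]
    nlinarith

/-- A power series converging absolutely, together with its derivative, on `c * s < 1`
can be differentiated, and `n G - (1 - c t) G'` has the expected coefficients. -/
lemma hasDerivAt_powerSeries {c : ℝ} (hc : 0 ≤ c) (n : ℝ) {g : ℕ → ℝ}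
    (hg : ∀ s, 0 < s → c * s < 1 → Summable fun k : ℕ => ((k : ℝ) + 1) * |g k| * s ^ k)
    {t : ℝ} (ht : 0 ≤ t) (hct : c * t < 1) :
    ∃ D, HasDerivAt (fun y => ∑' k, g k * y ^ k) D t ∧
      HasSum (fun k => g k * t ^ k) (∑' k, g k * t ^ k) ∧
      HasSum (fun k : ℕ => (k : ℝ) * g k * t ^ k) (t * D) ∧
      HasSum (fun k : ℕ => ((n + c * k) * g k - ((k : ℝ) + 1) * g (k + 1)) * t ^ k)
        (n * (∑' k, g k * t ^ k) - (1 - c * t) * D) := by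
  obtain ⟨s, hts, hcs⟩ := exists_gt_mul_lt_one hc hct
  have hs : 0 < s := ht.trans_lt hts
  have hsum := hg s hs hcs
  have hu : Summable fun k : ℕ => (k : ℝ) * |g k| * s ^ (k - 1) := by
    refine Summable.of_nonneg_of_le (fun k => by positivity) (fun k => ?_) (hsum.mul_left s⁻¹)
    rcases k with _ | k
    · simp
      positivity
    · rw [Nat.add_sub_cancel, pow_succ]
      have h : 0 ≤ |g (k + 1)| * s ^ k := by positivity
      have h2 : s⁻¹ * ((((k + 1 : ℕ) : ℝ) + 1) * |g (k + 1)| * (s ^ k * s))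
          = (((k + 1 : ℕ) : ℝ) + 1) * (|g (k + 1)| * s ^ k) := by
        field_simp
      rw [h2]
      nlinarith
  have hbound : ∀ (k : ℕ) (y : ℝ), y ∈ Set.Ioo (-s) s →
      ‖(k : ℝ) * g k * y ^ (k - 1)‖ ≤ (k : ℝ) * |g k| * s ^ (k - 1) := fun k y hy => by
    have : |y| ≤ s := (abs_lt.2 hy).le
    rw [norm_mul, norm_mul, norm_pow, Real.norm_eq_abs, Real.norm_eq_abs, Real.norm_eq_abs,
      Nat.abs_cast]
    gcongr
  have htmem : t ∈ Set.Ioo (-s) s := ⟨by linarith, hts⟩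
  have h0 : Summable fun k => g k * t ^ k := by
    refine Summable.of_norm_bounded hsum fun k => ?_
    rw [norm_mul, norm_pow, Real.norm_of_nonneg ht, Real.norm_eq_abs]
    have h1 : |g k| * t ^ k ≤ |g k| * s ^ k := by gcongr
    have h2 : 0 ≤ (k : ℝ) * (|g k| * s ^ k) := by positivity
    linarith
  have hD : HasSum (fun k : ℕ => (k : ℝ) * g k * t ^ (k - 1))
      (∑' k : ℕ, (k : ℝ) * g k * t ^ (k - 1)) :=
    (Summable.of_norm_bounded hu fun k => hbound k t htmem).hasSum
  set D := ∑' k : ℕ, (k : ℝ) * g k * t ^ (k - 1)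
  have hmul : HasSum (fun k : ℕ => (k : ℝ) * g k * t ^ k) (t * D) := by
    refine hasSum_of_forall_eq (hD.mul_left t) fun k => ?_
    rcases k with _ | k
    · simp
    · rw [Nat.add_sub_cancel, pow_succ]
      ring
  have hshift : HasSum (fun k : ℕ => ((k : ℝ) + 1) * g (k + 1) * t ^ k) D := by
    have := (hasSum_nat_add_iff' 1).2 hD
    simpa using this
  refine ⟨D, ?_, h0.hasSum, hmul, ?_⟩
  · refine hasDerivAt_tsum_of_isPreconnected hu isOpen_Ioo isPreconnected_Ioo
      (fun k y _ => ?_) hbound htmem h0 htmem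
    exact ((hasDerivAt_pow k y).const_mul (g k)).congr_deriv (by ring)
  · have h := ((h0.hasSum.mul_left n).add (hmul.mul_left c)).sub hshift
    rw [show n * (∑' k, g k * t ^ k) - (1 - c * t) * D
      = n * (∑' k, g k * t ^ k) + c * (t * D) - D by ring]
    exact hasSum_of_forall_eq h fun k => by ring

lemma summable_abs_risingCoeff {c n : ℝ} (hc : 0 ≤ c) (hn : 0 < n) (s : ℝ) (hs : 0 < s)
    (hcs : c * s < 1) :
    Summable fun k : ℕ => ((k : ℝ) + 1) * |risingCoeff c n k| * s ^ k := by
  refine Summable.of_nonneg_of_le (fun k => by positivity) (fun k => ?_)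
    (summable_risingCoeff hc hn hs hcs)
  have hb := risingCoeff_pos hc hn k
  rw [abs_of_pos hb]
  gcongr
  exact le_self_pow₀ (by linarith [(Nat.cast_nonneg k : (0 : ℝ) ≤ k)]) (by norm_num)

lemma summable_abs_risingCoeff_mul_log {c n : ℝ} (hc : 0 ≤ c) (hn : 0 < n) (s : ℝ) (hs : 0 < s)
    (hcs : c * s < 1) :
    Summable fun k : ℕ =>
      ((k : ℝ) + 1) * |risingCoeff c n k * Real.log (risingCoeff c n k)| * s ^ k := by
  refine Summable.of_nonneg_of_le (fun k => by positivity) (fun k => ?_)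
    ((summable_risingCoeff hc hn hs hcs).mul_left (n + c + 1 / n))
  have hb := risingCoeff_pos hc hn k
  rw [abs_mul, abs_of_pos hb]
  calc ((k : ℝ) + 1) * (risingCoeff c n k * |Real.log (risingCoeff c n k)|) * s ^ k
      ≤ ((k : ℝ) + 1) * (risingCoeff c n k * ((n + c + 1 / n) * ((k : ℝ) + 1) ^ 2)) * s ^ k := by
        gcongr
        refine (abs_log_risingCoeff_le hc hn k).trans ?_
        gcongr
        linarith
    _ = (n + c + 1 / n) * (((k : ℝ) + 1) ^ 3 * risingCoeff c n k * s ^ k) := by ring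

lemma mul_div_one_add_mul_lt_one {c x : ℝ} (hc : 0 ≤ c) (hx : 0 ≤ x) :
    c * (x / (1 + c * x)) < 1 := by
  have : 0 < 1 + c * x := by positivity
  rw [← mul_div_assoc, div_lt_one this]
  linarith

lemma one_sub_mul_div {c x : ℝ} (h : 1 + c * x ≠ 0) :
    1 - c * (x / (1 + c * x)) = 1 / (1 + c * x) := by
  field_simp
  ring

lemma pcZero_mul_tsum_risingCoeff {c n : ℝ} (hc : 0 ≤ c) (hn : 0 < n) {x : ℝ} (hx : 0 ≤ x) :
    pcZero c n x * ∑' k, risingCoeff c n k * (x / (1 + c * x)) ^ k = 1 := by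
  have hder : ∀ y, 0 ≤ y → HasDerivAt
      (fun y => pcZero c n y * ∑' k, risingCoeff c n k * (y / (1 + c * y)) ^ k) 0 y := by
    intro y hy
    have hpos : 0 < 1 + c * y := by positivity
    obtain ⟨D, hD, -, -, hS⟩ := hasDerivAt_powerSeries hc n (summable_abs_risingCoeff hc hn)
      (div_nonneg hy hpos.le) (mul_div_one_add_mul_lt_one hc hy)
    simp only [risingCoeff_succ, sub_self, zero_mul] at hS
    have hode := hS.unique hasSum_zero
    rw [one_sub_mul_div hpos.ne'] at hode
    refine ((hasDerivAt_pcZero hc n hy).mul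
      (hD.comp y (hasDerivAt_div_one_add_mul hpos.ne'))).congr_deriv ?_
    set B := ∑' k, risingCoeff c n k * (y / (1 + c * y)) ^ k
    have hB : n * B = D / (1 + c * y) := by
      rw [one_div, inv_mul_eq_div] at hode
      linarith
    have : -n * pcZero c n y / (1 + c * y) * B + pcZero c n y * (D * (1 / (1 + c * y) ^ 2))
        = pcZero c n y / (1 + c * y) * (D / (1 + c * y) - n * B) := by
      field_simp
      ring
    simp only [Function.comp]
    rw [this, hB]
    ring
  have hconst := constant_of_has_deriv_right_zero
    (fun y hy => (hder y (Set.mem_Icc.1 hy).1).continuousAt.continuousWithinAt)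
    (fun y hy => (hder y (Set.mem_Ico.1 hy).1).hasDerivWithinAt) x (Set.right_mem_Icc.2 hx)
  rw [hconst, zero_div, tsum_eq_single 0 fun k hk => by simp [hk]]
  by_cases h : c = 0 <;> simp [risingCoeff, pcZero, h]

lemma Hent_eq {c n : ℝ} (hc : 0 ≤ c) (hn : 0 < n) {x : ℝ} (hx : 0 < x) :
    Hent c n x = -Real.log (pcZero c n x) - n * x * Real.log (x / (1 + c * x))
      - pcZero c n x * ∑' k, risingCoeff c n k * Real.log (risingCoeff c n k)
        * (x / (1 + c * x)) ^ k := by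
  have hpos : 0 < 1 + c * x := by positivity
  have ht : 0 < x / (1 + c * x) := div_pos hx hpos
  have hct := mul_div_one_add_mul_lt_one hc hx.le
  have hφ := pcZero_pos hc n hx.le
  have hone := pcZero_mul_tsum_risingCoeff hc hn hx.le
  obtain ⟨D, -, hB, hM, hS⟩ :=
    hasDerivAt_powerSeries hc n (summable_abs_risingCoeff hc hn) ht.le hct
  obtain ⟨-, -, hG, -, -⟩ :=
    hasDerivAt_powerSeries hc n (summable_abs_risingCoeff_mul_log hc hn) ht.le hct
  simp only [risingCoeff_succ, sub_self, zero_mul] at hS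
  have hode := hS.unique hasSum_zero
  rw [one_sub_mul_div hpos.ne'] at hode
  set t := x / (1 + c * x) with ht_def
  set φ := pcZero c n x
  set B := ∑' k, risingCoeff c n k * t ^ k
  set G := ∑' k, risingCoeff c n k * Real.log (risingCoeff c n k) * t ^ k
  have hmean : φ * (t * D) = n * x := by
    have hD : D = n * B * (1 + c * x) := by
      field_simp at hode
      linarith
    calc φ * (t * D) = n * (t * (1 + c * x)) * (φ * B) := by rw [hD]; ring
      _ = n * x := by rw [hone, ht_def, div_mul_cancel₀ _ hpos.ne', mul_one]
  have hsum := ((hB.mul_left (φ * Real.log φ)).add (hM.mul_left (φ * Real.log t))).add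
    (hG.mul_left φ)
  unfold Hent
  rw [show (fun k => pc c n k x * Real.log (pc c n k x)) = _ from funext fun k => ?_, hsum.tsum_eq]
  · linear_combination (-Real.log φ) * hone - Real.log t * hmean
  · have hb := risingCoeff_pos hc hn k
    rw [pc_eq_risingCoeff hc n k hx.le, Real.log_mul (by positivity) hφ.ne',
      Real.log_mul hb.ne' (by positivity), Real.log_pow]
    ring

theorem stmt0 (c n : ℝ) (hc : 0 ≤ c) (hn : c < n) (x : ℝ) (hx : 0 < x) :
    deriv (Hent c n) x =
      n * (Real.log ((1 + c * x) / x)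
        + ∑' k : ℕ, pc c (n + c) k x * Real.log ((k + 1) / (n + c * k))) := by
  have hn0 : 0 < n := hc.trans_lt hn
  have hpos : 0 < 1 + c * x := by positivity
  have ht : 0 < x / (1 + c * x) := div_pos hx hpos
  have hφ := pcZero_pos hc n hx.le
  obtain ⟨D, hD, -, -, hS⟩ := hasDerivAt_powerSeries hc n
    (summable_abs_risingCoeff_mul_log hc hn0) ht.le (mul_div_one_add_mul_lt_one hc hx.le)
  have hq := hasDerivAt_div_one_add_mul hpos.ne'
  have hφ' := hasDerivAt_pcZero hc n hx.le
  have hder := (((hφ'.log hφ.ne').neg).sub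
    (((hasDerivAt_id x).const_mul n).mul (hq.log ht.ne'))).sub (hφ'.mul (hD.comp x hq))
  have hev : Hent c n =ᶠ[nhds x] _ :=
    Filter.eventually_of_mem (Ioi_mem_nhds hx) fun y hy => Hent_eq hc hn0 hy
  rw [hev.deriv_eq]
  refine hder.deriv.trans ?_
  have hsum : HasSum (fun k : ℕ => n * (pc c (n + c) k x * Real.log ((k + 1) / (n + c * k))))
      (pcZero c n x / (1 + c * x) * (n * (∑' k, risingCoeff c n k
        * Real.log (risingCoeff c n k) * (x / (1 + c * x)) ^ k)
        - (1 - c * (x / (1 + c * x))) * D)) := by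
    refine hasSum_of_forall_eq (hS.mul_left (pcZero c n x / (1 + c * x))) fun k => ?_
    have hb := risingCoeff_pos hc hn0 k
    have hb' := risingCoeff_pos hc hn0 (k + 1)
    have hr : 0 < n + c * k := by positivity
    have hk : (0 : ℝ) < k + 1 := by positivity
    have hlog : Real.log (k + 1) + Real.log (risingCoeff c n (k + 1))
        = Real.log (n + c * k) + Real.log (risingCoeff c n k) := by
      rw [← Real.log_mul hk.ne' hb'.ne', risingCoeff_succ, Real.log_mul hr.ne' hb.ne']
    rw [pc_eq_risingCoeff hc (n + c) k hx.le, pcZero_add hc n hx.le,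
      Real.log_div hk.ne' hr.ne', ← mul_assoc ((k : ℝ) + 1), risingCoeff_succ]
    set t := x / (1 + c * x)
    set φ := pcZero c n x / (1 + c * x)
    linear_combination
      t ^ k * φ * (Real.log (k + 1) - Real.log (n + c * k)) * risingCoeff_add c n k
        + (n + c * k) * risingCoeff c n k * t ^ k * φ * hlog
  rw [mul_add, ← tsum_mul_left, hsum.tsum_eq, one_sub_mul_div hpos.ne',
    ← inv_div x, Real.log_inv]
  simp only [Function.comp, id]
  field_simp
  ring
end

section
/- Let $n > 0$ be real. The function $x \mapsto H_{n,0}(x) + n x \log x$ is convex on $[0,+\infty)$. Moreover, for real $c > 0$ and $n > c$, the function $x \mapsto H_{n,c}(x) + \frac{n}{c}\left(cx\log x - (1+cx)\log(1+cx)\right)$ is convex on $[0,+\infty)$. -/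
namespace EntropyConvexity

open Filter Topology Finset

/-- The coefficient `∏_{i<k} (n + c i) / k!`. -/
noncomputable def coeff (c n : ℝ) (k : ℕ) : ℝ :=
  (∏ i ∈ range k, (n + c * i)) / (Nat.factorial k)

/-- `exp (-m x)` if `c = 0` and `(1 + c x) ^ (-m / c)` otherwise. -/
noncomputable def kern (c m x : ℝ) : ℝ :=
  if c = 0 then Real.exp (-(m * x)) else (1 + c * x) ^ (-m / c)

theorem pc_eq {c n x : ℝ} (k : ℕ) :
    pc c n k x = coeff c n k * x ^ k * kern c (n + c * k) x := by
  unfold pc coeff kern genBinom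
  split_ifs with h
  · subst h
    simp [mul_pow]
    ring
  · have h1 : ∏ i ∈ range k, (n + c * i) =
        (-1 : ℝ) ^ k * (∏ i ∈ range k, (-n / c - i)) * c ^ k := by
      induction k with
      | zero => simp
      | succ k ih =>
        rw [prod_range_succ, prod_range_succ, ih]
        field_simp
        ring
    have h2 : -(n + c * k) / c = -n / c - k := by field_simp; ring
    rw [h1, h2, mul_pow]
    ring

theorem coeff_pos {c n : ℝ} (hc : 0 ≤ c) (hn : 0 < n) (k : ℕ) : 0 < coeff c n k := by
  unfold coeff
  have : 0 < ∏ i ∈ range k, (n + c * i) := prod_pos fun i _ => by positivity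
  positivity

theorem coeff_zero (c n : ℝ) : coeff c n 0 = 1 := by simp [coeff]

theorem coeff_succ (c n : ℝ) (k : ℕ) :
    (k + 1) * coeff c n (k + 1) = (n + c * k) * coeff c n k := by
  unfold coeff
  rw [prod_range_succ, Nat.factorial_succ]
  push_cast
  field_simp

theorem coeff_succ' (c n : ℝ) (k : ℕ) :
    (k + 1) * coeff c n (k + 1) = n * coeff c (n + c) k := by
  unfold coeff
  have h : ∀ i ∈ range k, n + c * ((i + 1 : ℕ) : ℝ) = n + c + c * i := fun i _ => by
    push_cast; ring
  rw [prod_range_succ', Nat.factorial_succ, prod_congr rfl h]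
  push_cast
  field_simp
  simp [mul_comm]

theorem mul_coeff (c n : ℝ) (k : ℕ) :
    (n + c * k) * coeff c n k = n * coeff c (n + c) k := by
  rw [← coeff_succ, coeff_succ']

theorem one_add_mul_pos {c x : ℝ} (hc : 0 ≤ c) (hx : 0 ≤ x) : 0 < 1 + c * x := by positivity

theorem kern_pos {c x : ℝ} (hc : 0 ≤ c) (hx : 0 ≤ x) (m : ℝ) : 0 < kern c m x := by
  unfold kern
  split_ifs
  · positivity
  · exact Real.rpow_pos_of_pos (one_add_mul_pos hc hx) _

theorem log_kern {c x : ℝ} (hc : 0 ≤ c) (hx : 0 ≤ x) (m : ℝ) :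
    Real.log (kern c m x) = -m * (if c = 0 then x else Real.log (1 + c * x) / c) := by
  unfold kern
  split_ifs
  · simp
  · rw [Real.log_rpow (one_add_mul_pos hc hx)]
    ring

theorem hasDerivAt_kern {c x : ℝ} (hc : 0 ≤ c) (hx : 0 ≤ x) (m : ℝ) :
    HasDerivAt (kern c m) (-m * kern c (m + c) x) x := by
  rcases eq_or_ne c 0 with rfl | h
  · have h1 : kern 0 m = fun x => Real.exp (-(m * x)) := by ext; simp [kern]
    rw [h1]
    convert! ((hasDerivAt_id x).const_mul m).neg.exp using 1
    simp [kern]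
    ring
  · have h1 : kern c m = fun x => (1 + c * x) ^ (-m / c) := by ext; simp [kern, h]
    rw [h1]
    have h2 : HasDerivAt (fun x : ℝ => 1 + c * x) c x := by
      simpa using ((hasDerivAt_id x).const_mul c).const_add 1
    convert! h2.rpow_const (p := -m / c) (Or.inl (one_add_mul_pos hc hx).ne') using 1
    have h3 : -(m + c) / c = -m / c - 1 := by field_simp; ring
    simp only [kern, h, if_false, h3]
    field_simp

theorem pc_nonneg {c n x : ℝ} (hc : 0 ≤ c) (hn : 0 < n) (hx : 0 ≤ x) (k : ℕ) :
    0 ≤ pc c n k x := by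
  rw [pc_eq]
  have := coeff_pos hc hn k
  have := kern_pos hc hx (n + c * k)
  positivity

theorem succ_mul_pc (c n x : ℝ) (k : ℕ) :
    ((k + 1 : ℕ) : ℝ) * pc c n (k + 1) x = n * x * pc c (n + c) k x := by
  rw [pc_eq, pc_eq]
  have h : n + c * ((k + 1 : ℕ) : ℝ) = n + c + c * k := by push_cast; ring
  rw [h]
  push_cast
  linear_combination x ^ (k + 1) * kern c (n + c + c * k) x * coeff_succ' c n k

theorem hasDerivAt_pc_zero {c x : ℝ} (hc : 0 ≤ c) (hx : 0 ≤ x) (n : ℝ) :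
    HasDerivAt (pc c n 0) (-n * pc c (n + c) 0 x) x := by
  have h : pc c n 0 = kern c n := by ext y; simp [pc_eq, coeff_zero]
  rw [h]
  simpa [pc_eq, coeff_zero] using hasDerivAt_kern hc hx n

theorem hasDerivAt_pc_succ {c x : ℝ} (hc : 0 ≤ c) (hx : 0 ≤ x) (n : ℝ) (k : ℕ) :
    HasDerivAt (pc c n (k + 1)) (n * (pc c (n + c) k x - pc c (n + c) (k + 1) x)) x := by
  have h : pc c n (k + 1) =
      fun y => coeff c n (k + 1) * y ^ (k + 1) * kern c (n + c * (k + 1 : ℕ)) y := by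
    ext y; exact pc_eq _
  rw [h]
  convert! ((hasDerivAt_pow (k + 1) x).const_mul (coeff c n (k + 1))).mul
    (hasDerivAt_kern hc hx (n + c * (k + 1 : ℕ))) using 1
  rw [pc_eq, pc_eq]
  have h1 : n + c * ((k + 1 : ℕ) : ℝ) = n + c + c * k := by push_cast; ring
  have h2 : n + c + c * ((k + 1 : ℕ) : ℝ) = n + c + c * k + c := by push_cast; ring
  have h3 := mul_coeff c n (k + 1)
  rw [h1] at h3 ⊢
  rw [h2]
  push_cast
  linear_combination -x ^ k * kern c (n + c + c * k) x * coeff_succ' c n k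
    + x ^ (k + 1) * kern c (n + c + c * k + c) x * h3

theorem genBinom_eq_choose (a : ℝ) (k : ℕ) : genBinom a k = Ring.choose a k := by
  have h : (descPochhammer ℤ k).smeval a = ∏ i ∈ range k, (a - i) := by
    induction k with
    | zero => simp
    | succ k ih =>
      rw [prod_range_succ, ← ih]
      simp [descPochhammer_succ_right, Polynomial.smeval_mul, Polynomial.smeval_natCast]
  rw [Ring.choose_eq_smul, h, genBinom, smul_eq_mul]
  ring

theorem hasSum_pc {c n x : ℝ} (hc : 0 ≤ c) (hx : 0 ≤ x) :
    HasSum (fun k => pc c n k x) 1 := by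
  rcases hc.eq_or_lt with rfl | h
  · have h1 := (NormedSpace.expSeries_div_hasSum_exp (n * x)).mul_right (Real.exp (-(n * x)))
    rw [← Real.exp_eq_exp_ℝ, ← Real.exp_add, add_neg_cancel, Real.exp_zero] at h1
    simpa [pc] using h1
  · have hp := one_add_mul_pos hc hx
    have hy : -(c * x) / (1 + c * x) ∈ Metric.eball (0 : ℝ) 1 := by
      simp only [Metric.mem_eball, edist_zero_right]
      rw [← ofReal_norm, ENNReal.ofReal_lt_one, Real.norm_eq_abs, abs_div, abs_neg,
        abs_of_nonneg (by positivity : 0 ≤ c * x), abs_of_pos hp, div_lt_one hp]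
      linarith
    have h1 := (Real.one_add_rpow_hasFPowerSeriesOnBall_zero (a := -n / c)).hasSum hy
    have h2 := h1.mul_right ((1 + c * x) ^ (-n / c))
    have h3 : 1 + (0 + -(c * x) / (1 + c * x)) = (1 + c * x)⁻¹ := by field_simp; ring
    rw [h3, Real.inv_rpow hp.le, inv_mul_cancel₀ (Real.rpow_pos_of_pos hp _).ne'] at h2
    refine h2.congr_fun ?_
    intro k
    simp only [binomialSeries_apply, pc, h.ne', if_false, genBinom_eq_choose,
      Real.rpow_sub hp, Real.rpow_natCast]
    simp [div_pow, neg_pow (c * x)]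
    ring

theorem hasSum_mul_pc {c n x : ℝ} (hc : 0 ≤ c) (hx : 0 ≤ x) :
    HasSum (fun k : ℕ => (k : ℝ) * pc c n k x) (n * x) := by
  rw [← hasSum_nat_add_iff' 1]
  simp only [succ_mul_pc]
  simpa using (hasSum_pc (n := n + c) hc hx).mul_left (n * x)

theorem summable_sq_mul_pc {c n x : ℝ} (hc : 0 ≤ c) (hx : 0 ≤ x) :
    Summable (fun k : ℕ => (k : ℝ) ^ 2 * pc c n k x) := by
  rw [← summable_nat_add_iff 1]
  have h : ∀ k : ℕ, ((k + 1 : ℕ) : ℝ) ^ 2 * pc c n (k + 1) x =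
      n * x * (k * pc c (n + c) k x + pc c (n + c) k x) := fun k => by
    have := succ_mul_pc c n x k
    rw [sq, mul_assoc, this]
    push_cast
    ring
  simp only [h]
  exact ((hasSum_mul_pc hc hx).summable.add (hasSum_pc hc hx).summable).mul_left _

theorem hasDerivAt_sum_pc {c x : ℝ} (hc : 0 ≤ c) (hx : 0 ≤ x) (n : ℝ) (j : ℕ) :
    HasDerivAt (fun y => ∑ k ∈ range (j + 1), pc c n k y) (-n * pc c (n + c) j x) x := by
  induction j with
  | zero => simpa using hasDerivAt_pc_zero hc hx n
  | succ j ih =>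
    simp only [sum_range_succ _ (j + 1)]
    convert! ih.add (hasDerivAt_pc_succ hc hx n j) using 1
    ring

theorem hasDerivAt_sum_sum_pc {c x : ℝ} (hc : 0 ≤ c) (hx : 0 ≤ x) (n : ℝ) (j : ℕ) :
    HasDerivAt (fun y => ∑ i ∈ range j, ∑ k ∈ range (i + 1), pc c n k y)
      (-n * ∑ i ∈ range j, pc c (n + c) i x) x := by
  rw [mul_sum]
  exact HasDerivAt.fun_sum fun i _ => hasDerivAt_sum_pc hc hx n i

theorem convexOn_sum_sum_pc {c n : ℝ} (hc : 0 ≤ c) (hn : 0 < n) (j : ℕ) :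
    ConvexOn ℝ (Set.Ici 0) (fun y => ∑ i ∈ range j, ∑ k ∈ range (i + 1), pc c n k y) := by
  cases j with
  | zero => simpa using convexOn_const (0 : ℝ) (convex_Ici (0 : ℝ))
  | succ j =>
    refine convexOn_of_hasDerivWithinAt2_nonneg (convex_Ici 0)
      (f' := fun x => -n * ∑ i ∈ range (j + 1), pc c (n + c) i x)
      (f'' := fun x => -n * (-(n + c) * pc c (n + c + c) j x)) ?_ ?_ ?_ ?_
    · exact fun x hx => (hasDerivAt_sum_sum_pc hc hx n _).continuousAt.continuousWithinAt
    · exact fun x hx => (hasDerivAt_sum_sum_pc hc (interior_subset hx) n _).hasDerivWithinAt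
    · exact fun x hx => ((hasDerivAt_sum_pc hc (interior_subset hx) (n + c) j).const_mul
        (-n)).hasDerivWithinAt
    · intro x hx
      have := pc_nonneg (n := n + c + c) hc (by positivity) (interior_subset hx) j
      have : 0 ≤ n * ((n + c) * pc c (n + c + c) j x) := by positivity
      linarith

theorem hasSum_pc_mul_tsub {c n x : ℝ} (hc : 0 ≤ c) (hx : 0 ≤ x) (j : ℕ) :
    HasSum (fun k : ℕ => pc c n k x * ((k - j : ℕ) : ℝ))
      (n * x - j + ∑ i ∈ range j, ∑ k ∈ range (i + 1), pc c n k x) := by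
  induction j with
  | zero => simpa [mul_comm] using hasSum_mul_pc (n := n) hc hx
  | succ j ih =>
    have h1 : HasSum (fun k => if k ∈ range (j + 1) then pc c n k x else 0)
        (∑ k ∈ range (j + 1), pc c n k x) := by
      have := hasSum_sum_of_ne_finset_zero (L := .unconditional ℕ) (s := range (j + 1))
        (f := fun k => if k ∈ range (j + 1) then pc c n k x else 0) (fun k hk => if_neg hk)
      rwa [sum_congr rfl fun k hk => if_pos hk] at this
    convert! (ih.sub (hasSum_pc (n := n) hc hx)).add h1 using 1
    · ext k
      by_cases hk : k < j + 1
      · have h2 : k - (j + 1) = 0 := by omega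
        have h3 : k - j = 0 := by omega
        simp [hk, h2, h3]
      · have h2 : k - j = k - (j + 1) + 1 := by omega
        simp only [mem_range, hk, if_false, h2]
        push_cast
        ring
    · rw [sum_range_succ]
      push_cast
      ring

theorem convexOn_tsum_tsub {c n : ℝ} (hc : 0 ≤ c) (hn : 0 < n) (j : ℕ) :
    ConvexOn ℝ (Set.Ici 0) (fun x => ∑' k : ℕ, pc c n k x * ((k - j : ℕ) : ℝ)) := by
  have h1 : ConvexOn ℝ (Set.Ici 0) (fun x : ℝ => n * x - j) := by
    refine ⟨convex_Ici 0, fun x _ y _ a b _ _ hab => le_of_eq ?_⟩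
    simp only [smul_eq_mul]
    linear_combination (j : ℝ) * hab
  refine (h1.add (convexOn_sum_sum_pc hc hn j)).congr fun x hx => ?_
  exact (hasSum_pc_mul_tsub hc hx j).tsum_eq.symm

theorem convexOn_of_tendsto {f : ℕ → ℝ → ℝ} {g : ℝ → ℝ} {s : Set ℝ}
    (hf : ∀ M, ConvexOn ℝ s (f M)) (h : ∀ x ∈ s, Tendsto (fun M => f M x) atTop (𝓝 (g x))) :
    ConvexOn ℝ s g := by
  refine ⟨(hf 0).1, fun x hx y hy a b ha hb hab => ?_⟩
  exact le_of_tendsto_of_tendsto' (h _ ((hf 0).1 hx hy ha hb hab))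
    (((h x hx).const_smul a).add ((h y hy).const_smul b))
    fun M => (hf M).2 hx hy ha hb hab

/-- The second difference of a sequence. -/
def secondDiff (g : ℕ → ℝ) (j : ℕ) : ℝ := g (j + 2) - 2 * g (j + 1) + g j

/-- The sequence agreeing with `g` up to `M + 1` and continued affinely. -/
def affineTail (g : ℕ → ℝ) (M k : ℕ) : ℝ :=
  g 0 + k * (g 1 - g 0) + ∑ j ∈ range M, secondDiff g j * ((k - (j + 1) : ℕ) : ℝ)

theorem affineTail_self (g : ℕ → ℝ) (k : ℕ) : affineTail g k k = g k := by
  induction k with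
  | zero => simp [affineTail]
  | succ k ih =>
    have h1 : ∑ j ∈ range k, secondDiff g j = (g (k + 1) - g k) - (g 1 - g 0) := by
      rw [← sum_range_sub (fun i => g (i + 1) - g i)]
      exact sum_congr rfl fun j _ => by unfold secondDiff; ring
    have h2 : ∑ j ∈ range k, secondDiff g j * ((k + 1 - (j + 1) : ℕ) : ℝ) =
        ∑ j ∈ range k, secondDiff g j * ((k - (j + 1) : ℕ) : ℝ) + ∑ j ∈ range k, secondDiff g j := by
      rw [← sum_add_distrib]
      refine sum_congr rfl fun j hj => ?_
      have : k + 1 - (j + 1) = k - (j + 1) + 1 := by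
        have := mem_range.1 hj
        omega
      rw [this]
      push_cast
      ring
    unfold affineTail at ih ⊢
    rw [sum_range_succ, h2, h1]
    simp only [Nat.sub_self]
    push_cast
    linear_combination ih

theorem affineTail_of_le (g : ℕ → ℝ) {M k : ℕ} (h : k ≤ M) : affineTail g M k = g k := by
  rw [← affineTail_self g k]
  unfold affineTail
  congr 1
  symm
  refine sum_subset (range_subset_range.2 h) fun j _ hj => ?_
  have : k - (j + 1) = 0 := by
    have := mem_range.not.1 hj
    omega
  simp [this]

theorem abs_affineTail_le {g : ℕ → ℝ} (hg : ∀ j, 0 ≤ secondDiff g j) (h0 : g 0 = 0) (M k : ℕ) :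
    |affineTail g M k| ≤ |g k| + k * |g 1| := by
  have h1 : ∀ M, (k : ℝ) * g 1 ≤ affineTail g M k := fun M => by
    have : 0 ≤ ∑ j ∈ range M, secondDiff g j * ((k - (j + 1) : ℕ) : ℝ) :=
      sum_nonneg fun j _ => mul_nonneg (hg j) (Nat.cast_nonneg _)
    unfold affineTail
    rw [h0]
    linarith
  have h2 : affineTail g M k ≤ g k := by
    rcases le_total k M with h | h
    · exact (affineTail_of_le g h).le
    · rw [← affineTail_self g k]
      unfold affineTail
      gcongr
      exact fun j _ _ => mul_nonneg (hg j) (Nat.cast_nonneg _)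
  have h3 : (k : ℝ) * -|g 1| ≤ k * g 1 := by gcongr; exact neg_abs_le _
  have h4 := h1 M
  have h5 := le_abs_self (g k)
  have h6 := abs_nonneg (g k)
  have h7 : 0 ≤ (k : ℝ) * |g 1| := by positivity
  rw [abs_le]
  constructor <;> linarith

theorem summable_pc_mul {c n x C : ℝ} (hc : 0 ≤ c) (hn : 0 < n) (hx : 0 ≤ x) {g : ℕ → ℝ}
    (hC : ∀ k, |g k| ≤ C * k ^ 2) : Summable (fun k => pc c n k x * g k) := by
  refine Summable.of_norm_bounded ((summable_sq_mul_pc (n := n) hc hx).mul_left C) fun k => ?_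
  have hp := pc_nonneg hc hn hx k
  rw [norm_mul, Real.norm_of_nonneg hp, Real.norm_eq_abs]
  calc pc c n k x * |g k| ≤ pc c n k x * (C * k ^ 2) := by gcongr; exact hC k
    _ = C * (k ^ 2 * pc c n k x) := by ring

theorem convexOn_tsum_affineTail {c n : ℝ} (hc : 0 ≤ c) (hn : 0 < n) {g : ℕ → ℝ}
    (hg : ∀ j, 0 ≤ secondDiff g j) (M : ℕ) :
    ConvexOn ℝ (Set.Ici 0) (fun x => ∑' k, pc c n k x * affineTail g M k) := by
  have h1 : ConvexOn ℝ (Set.Ici 0) (fun x : ℝ => g 0 + n * x * (g 1 - g 0)) := by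
    refine ⟨convex_Ici 0, fun x _ y _ a b _ _ hab => le_of_eq ?_⟩
    simp only [smul_eq_mul]
    linear_combination -g 0 * hab
  have h2 : ConvexOn ℝ (Set.Ici 0) (fun x => ∑ j ∈ range M,
      secondDiff g j * ∑' k : ℕ, pc c n k x * ((k - (j + 1) : ℕ) : ℝ)) := by
    induction M with
    | zero => simpa using convexOn_const (0 : ℝ) (convex_Ici (0 : ℝ))
    | succ M ih =>
      simp only [sum_range_succ]
      exact ih.add ((convexOn_tsum_tsub hc hn (M + 1)).smul (hg M))
  refine (h1.add h2).congr fun x hx => ?_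
  have h3 : HasSum (fun k => ∑ j ∈ range M, secondDiff g j * (pc c n k x * ((k - (j + 1) : ℕ) : ℝ)))
      (∑ j ∈ range M, secondDiff g j * ∑' k : ℕ, pc c n k x * ((k - (j + 1) : ℕ) : ℝ)) :=
    hasSum_sum fun j _ => ((hasSum_pc_mul_tsub hc hx (j + 1)).summable.hasSum).mul_left _
  have h4 := (((hasSum_pc (n := n) hc hx).mul_right (g 0)).add
    ((hasSum_mul_pc (n := n) hc hx).mul_right (g 1 - g 0))).add h3
  rw [one_mul] at h4
  refine (h4.tsum_eq.symm.trans (tsum_congr fun k => ?_))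
  unfold affineTail
  rw [mul_add, mul_sum]
  congr 1
  · ring
  · exact sum_congr rfl fun j _ => by ring

theorem convexOn_tsum {c n C : ℝ} (hc : 0 ≤ c) (hn : 0 < n) {g : ℕ → ℝ}
    (hg : ∀ j, 0 ≤ secondDiff g j) (hC : ∀ k, |g k| ≤ C * k ^ 2) :
    ConvexOn ℝ (Set.Ici 0) (fun x => ∑' k, pc c n k x * g k) := by
  refine convexOn_of_tendsto (convexOn_tsum_affineTail hc hn hg) fun x hx => ?_
  have h0 : g 0 = 0 := by simpa using hC 0
  refine tendsto_tsum_of_dominated_convergence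
    (bound := fun k => pc c n k x * ((C + |g 1|) * k ^ 2))
    (summable_pc_mul (C := abs (C + abs (g 1))) hc hn hx fun k => ?_) (fun k => ?_)
    (Eventually.of_forall fun M k => ?_)
  · rw [abs_mul, abs_of_nonneg (by positivity : (0 : ℝ) ≤ (k : ℝ) ^ 2)]
  · refine tendsto_const_nhds.congr' ?_
    filter_upwards [eventually_ge_atTop k] with M hM
    rw [affineTail_of_le g hM]
  · have hp := pc_nonneg hc hn hx k
    rw [norm_mul, Real.norm_of_nonneg hp, Real.norm_eq_abs]
    gcongr
    have h1 : (k : ℝ) ≤ k ^ 2 := by exact_mod_cast Nat.le_self_pow two_ne_zero k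
    have h2 : (k : ℝ) * |g 1| ≤ k ^ 2 * |g 1| := by gcongr
    linarith [abs_affineTail_le hg h0 M k, hC k]

theorem log_coeff_succ {c n : ℝ} (hc : 0 ≤ c) (hn : 0 < n) (k : ℕ) :
    Real.log (coeff c n (k + 1)) =
      Real.log (coeff c n k) + Real.log (n + c * k) - Real.log (k + 1) := by
  have h := congrArg Real.log (coeff_succ c n k)
  rw [Real.log_mul (by positivity) (coeff_pos hc hn _).ne',
    Real.log_mul (by positivity) (coeff_pos hc hn _).ne'] at h
  linarith

theorem secondDiff_neg_log_coeff_nonneg {c n : ℝ} (hc : 0 ≤ c) (hn : 0 < n) (hcn : c ≤ n) (j : ℕ) :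
    0 ≤ secondDiff (fun k => -Real.log (coeff c n k)) j := by
  have h1 := log_coeff_succ hc hn j
  have h2 := log_coeff_succ hc hn (j + 1)
  push_cast at h2
  have h3 : Real.log ((n + c * (j + 1)) * (j + 1)) ≤ Real.log ((n + c * j) * (j + 1 + 1)) := by
    apply Real.log_le_log (by positivity)
    nlinarith
  rw [Real.log_mul (by positivity) (by positivity),
    Real.log_mul (by positivity) (by positivity)] at h3
  unfold secondDiff
  simp only
  linarith

theorem abs_log_coeff_le {c n : ℝ} (hc : 0 ≤ c) (hn : 0 < n) (hcn : c ≤ n) (k : ℕ) :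
    |-Real.log (coeff c n k)| ≤ (1 + |Real.log n|) * k ^ 2 := by
  have h : |-Real.log (coeff c n k)| ≤ k ^ 2 + k * |Real.log n| := by
    induction k with
    | zero => simp [coeff_zero]
    | succ k ih =>
      have h1 : 0 ≤ Real.log ((k : ℝ) + 1) := Real.log_nonneg (by simp)
      have h2 : Real.log ((k : ℝ) + 1) ≤ k := by
        have := Real.log_le_sub_one_of_pos (by positivity : (0 : ℝ) < k + 1)
        linarith
      have h3 : Real.log n ≤ Real.log (n + c * k) :=
        Real.log_le_log hn (by nlinarith [mul_nonneg hc (Nat.cast_nonneg k : (0 : ℝ) ≤ k)])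
      have h4 : Real.log (n + c * k) ≤ Real.log (n * (k + 1)) :=
        Real.log_le_log (by positivity)
          (by nlinarith [mul_le_mul_of_nonneg_right hcn (Nat.cast_nonneg k : (0 : ℝ) ≤ k)])
      rw [Real.log_mul (by positivity) (by positivity)] at h4
      have h5 := abs_le.1 ih
      have h6 := le_abs_self (Real.log n)
      have h7 := neg_abs_le (Real.log n)
      rw [log_coeff_succ hc hn, abs_le]
      push_cast
      constructor <;> nlinarith
  have h1 : (k : ℝ) ≤ k ^ 2 := by exact_mod_cast Nat.le_self_pow two_ne_zero k
  have h2 : (k : ℝ) * |Real.log n| ≤ k ^ 2 * |Real.log n| := by gcongr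
  linarith

theorem pc_mul_log_pc {c n x : ℝ} (hc : 0 ≤ c) (hn : 0 < n) (hx : 0 ≤ x) (k : ℕ) :
    pc c n k x * Real.log (pc c n k x) = pc c n k x * (Real.log (coeff c n k) + k * Real.log x
      - (n + c * k) * (if c = 0 then x else Real.log (1 + c * x) / c)) := by
  by_cases h : x ^ k = 0
  · simp [pc_eq, h]
  · congr 1
    rw [pc_eq, Real.log_mul (mul_ne_zero (coeff_pos hc hn k).ne' h) (kern_pos hc hx _).ne',
      Real.log_mul (coeff_pos hc hn k).ne' h, Real.log_pow, log_kern hc hx]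
    ring

theorem Hent_eq {c n x : ℝ} (hc : 0 ≤ c) (hn : 0 < n) (hcn : c ≤ n) (hx : 0 ≤ x) :
    Hent c n x = ∑' k, pc c n k x * (-Real.log (coeff c n k)) - n * x * Real.log x
      + n * (1 + c * x) * (if c = 0 then x else Real.log (1 + c * x) / c) := by
  set l := if c = 0 then x else Real.log (1 + c * x) / c with hl
  have h1 := (summable_pc_mul hc hn hx (abs_log_coeff_le hc hn hcn)).hasSum
  have h2 := hasSum_pc (n := n) hc hx
  have h3 := hasSum_mul_pc (n := n) hc hx
  have h4 := ((h1.neg.add (h3.mul_right (Real.log x - c * l))).sub (h2.mul_right (n * l))).tsum_eq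
  unfold Hent
  rw [tsum_congr fun k => pc_mul_log_pc hc hn hx k, ← hl]
  rw [neg_eq_iff_eq_neg]
  convert! h4 using 1
  · exact tsum_congr fun k => by ring
  · ring

end EntropyConvexity

theorem stmt1 :
    (∀ n : ℝ, 0 < n →
      ConvexOn ℝ (Set.Ici 0) (fun x : ℝ => Hent 0 n x + n * x * Real.log x)) ∧
    (∀ c n : ℝ, 0 < c → c < n →
      ConvexOn ℝ (Set.Ici 0) (fun x : ℝ =>
        Hent c n x + n / c * (c * x * Real.log x
          - (1 + c * x) * Real.log (1 + c * x)))) := by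
  open EntropyConvexity in
  refine ⟨fun n hn => ?_, fun c n hc hcn => ?_⟩
  · have h1 : ConvexOn ℝ (Set.Ici 0) (fun x : ℝ => n * x) :=
      ((convexOn_id (convex_Ici (0 : ℝ))).smul hn.le)
    refine ((convexOn_tsum le_rfl hn (secondDiff_neg_log_coeff_nonneg le_rfl hn hn.le)
      (abs_log_coeff_le le_rfl hn hn.le)).add h1).congr fun x hx => ?_
    simp only [Pi.add_apply]
    rw [Hent_eq le_rfl hn hn.le hx, if_pos rfl]
    ring
  · have hn := hc.trans hcn
    refine (convexOn_tsum hc.le hn (secondDiff_neg_log_coeff_nonneg hc.le hn hcn.le)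
      (abs_log_coeff_le hc.le hn hcn.le)).congr fun x hx => ?_
    simp only
    rw [Hent_eq hc.le hn hcn.le hx, if_neg hc.ne']
    field_simp
    ring
end

section
/- Let $c \ge 0$ and $n > c$ be real numbers. For every $x > 0$, $\log\frac{x}{1+cx} \le \sum_{k=0}^\infty p_{n+c,k}^{[c]}(x)\,\log\frac{k+1}{ck+n} \le \log\frac{x+\frac{1}{n}}{1+cx}$. -/
theorem genBinom_eq_choose (α : ℝ) (k : ℕ) : genBinom α k = Ring.choose α k := by
  have h := Ring.descPochhammer_eq_factorial_smul_choose α k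
  have h2 : (descPochhammer ℤ k).smeval α = ∏ i ∈ Finset.range k, (α - i) := by
    rw [← descPochhammer_eval_eq_prod_range, ← descPochhammer_map (algebraMap ℤ ℝ),
      Polynomial.eval_map_algebraMap, Polynomial.aeval_eq_smeval]
  rw [genBinom, ← h2, h, nsmul_eq_mul]
  field_simp

theorem mul_genBinom_sub_one_left (α : ℝ) (k : ℕ) :
    α * genBinom (α - 1) k = (k + 1) * genBinom α (k + 1) := by
  have h : ∀ i : ℕ, α - 1 - i = α - (i + 1 : ℕ) := fun i ↦ by push_cast; ring
  simp only [genBinom, Finset.prod_range_succ', h, Nat.factorial_succ]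
  push_cast
  field_simp
  ring

theorem succ_mul_genBinom_succ (α : ℝ) (k : ℕ) :
    (k + 1) * genBinom α (k + 1) = (α - k) * genBinom α k := by
  simp only [genBinom, Finset.prod_range_succ, Nat.factorial_succ]
  push_cast
  field_simp

theorem succ_mul_pc_succ {c n x : ℝ} (hc : 0 ≤ c) (hx : 0 < x) (k : ℕ) :
    (k + 1) * pc c n (k + 1) x = n * x * pc c (n + c) k x := by
  unfold pc
  split_ifs with h
  · subst h
    rw [Nat.factorial_succ, add_zero]
    push_cast
    field_simp
    ring
  · have hexp : -n / c - ((k + 1 : ℕ) : ℝ) = -(n + c) / c - k := by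
      push_cast
      field_simp
      ring
    have hα : -(n + c) / c = -n / c - 1 := by
      field_simp
      ring
    have hg := mul_genBinom_sub_one_left (-n / c) k
    rw [hexp, hα]
    calc _ = (-1) ^ (k + 1) * ((k + 1) * genBinom (-n / c) (k + 1)) * (c * x) ^ (k + 1) *
          (1 + c * x) ^ (-n / c - 1 - k) := by ring
      _ = _ := by
        rw [← hg]
        field_simp
        ring

theorem add_mul_pc {c n x : ℝ} (hc : 0 ≤ c) (hx : 0 < x) (k : ℕ) :
    (c * k + n) * pc c n k x = n * (1 + c * x) * pc c (n + c) k x := by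
  unfold pc
  split_ifs with h
  · subst h
    simp
  · have hpos : 0 < 1 + c * x := by positivity
    have hα : -(n + c) / c = -n / c - 1 := by
      field_simp
      ring
    have hg := (mul_genBinom_sub_one_left (-n / c) k).trans (succ_mul_genBinom_succ (-n / c) k)
    have hrpow : (1 + c * x) ^ (-n / c - k) =
        (1 + c * x) ^ (-n / c - 1 - k) * (1 + c * x) := by
      rw [← Real.rpow_add_one hpos.ne']
      ring_nf
    rw [hα, hrpow]
    have hg' : (c * k + n) * genBinom (-n / c) k = n * genBinom (-n / c - 1) k := by
      field_simp at hg ⊢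
      linarith
    linear_combination ((-1) ^ k * (c * x) ^ k * ((1 + c * x) ^ (-n / c - 1 - k) *
      (1 + c * x))) * hg'

theorem add_mul_mul_pc {c n x : ℝ} (hc : 0 ≤ c) (hx : 0 < x) (k : ℕ) :
    (c * k + n) * x * pc c n k x = (k + 1) * (1 + c * x) * pc c n (k + 1) x := by
  linear_combination x * add_mul_pc (n := n) hc hx k -
    (1 + c * x) * succ_mul_pc_succ (n := n) hc hx k

theorem pc_nonneg {c n x : ℝ} (hc : 0 ≤ c) (hn : 0 < n) (hx : 0 < x) (k : ℕ) :
    0 ≤ pc c n k x := by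
  induction k with
  | zero =>
    unfold pc
    split_ifs
    · positivity
    · simp only [genBinom]
      simp only [Finset.range_zero, Finset.prod_empty, pow_zero]
      positivity
  | succ k ih =>
    have h := add_mul_mul_pc (n := n) hc hx k
    have h0 : 0 ≤ (c * k + n) * x * pc c n k x := by positivity
    rw [h] at h0
    exact nonneg_of_mul_nonneg_right h0 (by positivity)

theorem hasSum_pc {c n x : ℝ} (hc : 0 ≤ c) (hx : 0 < x) :
    HasSum (fun k ↦ pc c n k x) 1 := by
  rcases hc.eq_or_lt with rfl | hc
  · have h := (NormedSpace.expSeries_div_hasSum_exp (n * x)).mul_right (Real.exp (-(n * x)))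
    rw [← Real.exp_eq_exp_ℝ, ← Real.exp_add, add_neg_cancel, Real.exp_zero] at h
    simpa [pc] using h
  · have hpos : 0 < 1 + c * x := by positivity
    have hmem : -(c * x / (1 + c * x)) ∈ Metric.eball (0 : ℝ) 1 := by
      rw [← ENNReal.ofReal_one, Metric.eball_ofReal, mem_ball_zero_iff, norm_neg, Real.norm_eq_abs,
        abs_of_nonneg (by positivity), div_lt_one hpos]
      linarith
    have h := ((Real.one_add_rpow_hasFPowerSeriesOnBall_zero (a := -n / c)).hasSum hmem).mul_right
      ((1 + c * x) ^ (-n / c))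
    have hbase : (1 + (0 + -(c * x / (1 + c * x)))) = (1 + c * x)⁻¹ := by
      field_simp
      ring
    rw [hbase, Real.inv_rpow hpos.le, inv_mul_cancel₀ (Real.rpow_pos_of_pos hpos _).ne'] at h
    refine h.congr_fun fun k ↦ ?_
    rw [pc, if_neg hc.ne', genBinom_eq_choose, binomialSeries_apply, Real.rpow_sub hpos,
      Real.rpow_natCast, List.ofFn_const, List.prod_replicate, smul_eq_mul,
      neg_pow (c * x / (1 + c * x)), div_pow]
    ring

theorem hasSum_pc_mul_ratio {c n x : ℝ} (hc : 0 ≤ c) (hn : 0 < n) (hx : 0 < x) :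
    HasSum (fun k : ℕ ↦ pc c (n + c) k x * ((k + 1) / (c * k + n)))
      ((x + 1 / n) / (1 + c * x)) := by
  have hpos : 0 < 1 + c * x := by positivity
  have hmean : HasSum (fun k : ℕ ↦ k * pc c n k x) (n * x) := by
    rw [← hasSum_nat_add_iff' 1]
    have h := (hasSum_pc (n := n + c) hc hx).mul_left (n * x)
    simpa [succ_mul_pc_succ hc hx] using h
  have h := (hmean.add (hasSum_pc (n := n) hc hx)).div_const (n * (1 + c * x))
  convert! h using 1
  · ext k
    have hk : 0 < c * k + n := by positivity
    have := add_mul_pc (n := n) hc hx k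
    rw [← mul_div_assoc, div_eq_div_iff hk.ne' (by positivity)]
    linear_combination -(k + 1 : ℝ) * this
  · field_simp

/-- Gibbs-type form of Jensen's inequality for the logarithm and an upper bound on the mean. -/
theorem mul_log_le {p a m : ℝ} (hp : 0 ≤ p) (ha : 0 < a) (hm : 0 < m) :
    p * Real.log a ≤ p * a / m + p * (Real.log m - 1) := by
  have h := Real.log_le_sub_one_of_pos (div_pos ha hm)
  rw [Real.log_div ha.ne' hm.ne'] at h
  calc p * Real.log a ≤ p * (a / m + (Real.log m - 1)) :=
        mul_le_mul_of_nonneg_left (by linarith) hp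
    _ = _ := by ring

theorem stmt2 (c n : ℝ) (hc : 0 ≤ c) (hn : c < n) (x : ℝ) (hx : 0 < x) :
    Real.log (x / (1 + c * x))
        ≤ ∑' k : ℕ, pc c (n + c) k x * Real.log ((k + 1) / (c * k + n)) ∧
    (∑' k : ℕ, pc c (n + c) k x * Real.log ((k + 1) / (c * k + n)))
        ≤ Real.log ((x + 1 / n) / (1 + c * x)) := by
  have hn0 : 0 < n := hc.trans_lt hn
  have hpos : 0 < 1 + c * x := by positivity
  have hp := pc_nonneg hc (add_pos_of_pos_of_nonneg hn0 hc) hx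
  have hsum := hasSum_pc (n := n + c) hc hx
  set M := (x + 1 / n) / (1 + c * x) with hM
  have hM0 : 0 < M := by positivity
  set L := x / (1 + c * x) with hL
  have hL0 : 0 < L := by positivity
  have hupper : HasSum (fun k : ℕ ↦ pc c (n + c) k x * ((k + 1) / (c * k + n)) / M +
      pc c (n + c) k x * (Real.log M - 1)) (Real.log M) := by
    convert! ((hasSum_pc_mul_ratio hc hn0 hx).div_const M).add
      (hsum.mul_right (Real.log M - 1)) using 1
    rw [← hM, div_self hM0.ne']
    ring
  have hshift : HasSum (fun k ↦ pc c (n + c) (k + 1) x) (1 - pc c (n + c) 0 x) := by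
    simpa using (hasSum_nat_add_iff' 1).2 hsum
  have hlower := (hsum.mul_right (Real.log L + 1)).sub hshift
  have hle_upper : ∀ k : ℕ, pc c (n + c) k x * Real.log ((k + 1) / (c * k + n)) ≤
      pc c (n + c) k x * ((k + 1) / (c * k + n)) / M + pc c (n + c) k x * (Real.log M - 1) :=
    fun k ↦ mul_log_le (hp k) (by positivity) hM0
  have hle_lower : ∀ k : ℕ, pc c (n + c) k x * (Real.log L + 1) - pc c (n + c) (k + 1) x ≤
      pc c (n + c) k x * Real.log ((k + 1) / (c * k + n)) := by
    intro k
    have hk : 0 < c * k + n := by positivity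
    have h := mul_log_le (hp k) (a := ((k + 1) / (c * k + n))⁻¹) (m := L⁻¹)
      (by positivity) (by positivity)
    rw [Real.log_inv, Real.log_inv] at h
    have hb : pc c (n + c) k x * ((k + 1) / (c * k + n) : ℝ)⁻¹ / L⁻¹ ≤
        pc c (n + c) (k + 1) x := by
      have hrec := add_mul_mul_pc (n := n + c) hc hx k
      have hcp : 0 ≤ c * (x * pc c (n + c) k x) := mul_nonneg hc (mul_nonneg hx.le (hp k))
      rw [hL, inv_div, inv_div, div_div_eq_mul_div, mul_div_assoc', div_mul_eq_mul_div, div_div,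
        div_le_iff₀ (by positivity)]
      linarith
    linarith
  have hsummable : Summable fun k : ℕ ↦
      pc c (n + c) k x * Real.log ((k + 1) / (c * k + n)) := by
    have h := Summable.of_nonneg_of_le (fun k ↦ sub_nonneg.2 (hle_lower k))
      (fun k ↦ sub_le_sub_right (hle_upper k) _) (hupper.summable.sub hlower.summable)
    simpa using h.add hlower.summable
  refine ⟨?_, hasSum_le hle_upper hsummable.hasSum hupper⟩
  have h := hasSum_le hle_lower hlower hsummable.hasSum
  linarith [hp 0]
end

section
/- For every $n \in \mathbb{N}$ and every $x$ with $0 < x < \frac{1}{2}$, $\log\frac{x}{1-x} < \sum_{k=0}^n \binom{n}{k} x^k (1-x)^{n-k} \log\frac{k+1}{n+1-k} < \log\left(\frac{x}{1-x} + \frac{1-(n+2)x^{n+1}}{(n+1)(1-x)}\right)$. -/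
/-- The mean of `a K` for a binomial variable `K` with parameters `n` and `x`. -/
def binomialMean (n : ℕ) (a : ℕ → ℝ) (x : ℝ) : ℝ :=
  ∑ k ∈ Finset.range (n + 1), (Nat.choose n k : ℝ) * x ^ k * (1 - x) ^ (n - k) * a k

theorem binomialMean_eq_eval (n : ℕ) (a : ℕ → ℝ) (x : ℝ) :
    binomialMean n a x =
      (∑ k ∈ Finset.range (n + 1),
        bernsteinPolynomial ℝ n k * Polynomial.C (a k)).eval x := by
  simp [binomialMean, bernsteinPolynomial, Polynomial.eval_finsetSum]

theorem hasDerivAt_binomialMean_succ (n : ℕ) (a : ℕ → ℝ) (x : ℝ) :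
    HasDerivAt (binomialMean (n + 1) a)
      ((n + 1) * binomialMean n (fun k => a (k + 1) - a k) x) x := by
  have h := (∑ k ∈ Finset.range (n + 1 + 1),
    bernsteinPolynomial ℝ (n + 1) k * Polynomial.C (a k)).hasDerivAt x
  rw [show binomialMean (n + 1) a = _ from funext (binomialMean_eq_eval (n + 1) a)]
  refine h.congr_deriv (Eq.symm ?_)
  rw [binomialMean_eq_eval, Finset.sum_range_succ' _ (n + 1)]
  have h1 := Finset.sum_range_succ'
    (fun k => (bernsteinPolynomial ℝ n k).eval x * a k) (n + 1)
  rw [Finset.sum_range_succ, bernsteinPolynomial.eq_zero_of_lt ℝ (Nat.lt_succ_self n)] at h1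
  simp only [Polynomial.derivative_add, Polynomial.derivative_sum, Polynomial.derivative_mul,
    Polynomial.derivative_C, bernsteinPolynomial.derivative_succ,
    bernsteinPolynomial.derivative_zero, Polynomial.eval_finsetSum, Polynomial.eval_add,
    Polynomial.eval_mul, Polynomial.eval_sub, Polynomial.eval_C, Polynomial.eval_neg,
    Polynomial.eval_natCast, Polynomial.eval_zero, mul_zero, add_zero, zero_mul,
    Nat.add_sub_cancel, mul_sub, sub_mul, Finset.sum_sub_distrib, mul_assoc,
    ← Finset.mul_sum] at h1 ⊢
  push_cast
  linear_combination (-(n : ℝ) - 1) * h1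

theorem sum_binomial_eq_one (n : ℕ) (x : ℝ) :
    ∑ k ∈ Finset.range (n + 1), (Nat.choose n k : ℝ) * x ^ k * (1 - x) ^ (n - k) = 1 := by
  have h := add_pow x (1 - x) n
  rw [add_sub_cancel, one_pow] at h
  exact (Finset.sum_congr rfl fun k _ => by ring).trans h.symm

theorem binomialMean_reflect (n : ℕ) (a : ℕ → ℝ) (x : ℝ) :
    binomialMean n (fun k => a (n - k)) x = binomialMean n a (1 - x) := by
  unfold binomialMean
  rw [← Finset.sum_range_reflect]
  refine Finset.sum_congr rfl fun k hk => ?_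
  have hk' : k ≤ n := Nat.lt_succ_iff.mp (Finset.mem_range.mp hk)
  simp only [Nat.add_sub_cancel, Nat.choose_symm hk', Nat.sub_sub_self hk', sub_sub_cancel]
  ring

theorem mul_mul_binomialMean_inv_succ (n : ℕ) (x : ℝ) :
    x * ((n + 1) * binomialMean n (fun k => ((k : ℝ) + 1)⁻¹) x) = 1 - (1 - x) ^ (n + 1) := by
  have h := sum_binomial_eq_one (n + 1) x
  rw [Finset.sum_range_succ'] at h
  simp only [Nat.choose_zero_right, Nat.cast_one, pow_zero, one_mul, Nat.sub_zero,
    Nat.add_sub_add_right] at h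
  rw [← eq_sub_of_add_eq h, binomialMean, Finset.mul_sum, Finset.mul_sum]
  refine Finset.sum_congr rfl fun k _ => ?_
  have hc : ((n : ℝ) + 1) * n.choose k = (n + 1).choose (k + 1) * (k + 1) := by
    exact_mod_cast Nat.add_one_mul_choose_eq n k
  have hk : (k : ℝ) + 1 ≠ 0 := by positivity
  field_simp
  linear_combination x * x ^ k * (1 - x) ^ (n - k) * hc

theorem binomialMean_mono (n : ℕ) {a b : ℕ → ℝ} (h : ∀ k, a k ≤ b k) {x : ℝ}
    (hx : 0 ≤ x) (hx1 : x ≤ 1) : binomialMean n a x ≤ binomialMean n b x := by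
  have : 0 ≤ 1 - x := sub_nonneg.2 hx1
  unfold binomialMean
  gcongr with k
  exact h k

theorem strictAntiOn_binomialMean_log_succ_sub_log (n : ℕ) :
    StrictAntiOn (fun x => binomialMean (n + 1) (fun k => Real.log (k + 1)) x - Real.log x)
      (Set.Ioo 0 1) := by
  have hd : ∀ x ∈ Set.Ioo (0 : ℝ) 1, HasDerivAt
      (fun x => binomialMean (n + 1) (fun k => Real.log (k + 1)) x - Real.log x)
      ((n + 1) * binomialMean n
        (fun k => Real.log ((k + 1 : ℕ) + 1) - Real.log (k + 1)) x - x⁻¹) x := fun x hx =>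
    (hasDerivAt_binomialMean_succ n _ x).sub (Real.hasDerivAt_log hx.1.ne')
  refine strictAntiOn_of_deriv_neg (convex_Ioo 0 1)
    (fun x hx => (hd x hx).continuousAt.continuousWithinAt) fun x hx => ?_
  rw [interior_Ioo] at hx
  rw [(hd x hx).deriv, sub_neg]
  have hlog : ∀ k : ℕ, Real.log ((k + 1 : ℕ) + 1) - Real.log (k + 1) ≤ ((k : ℝ) + 1)⁻¹ := by
    intro k
    have hk : (0 : ℝ) < k + 1 := by positivity
    rw [← Real.log_div (by positivity) hk.ne']
    refine (Real.log_le_sub_one_of_pos (by positivity)).trans (le_of_eq ?_)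
    push_cast
    field_simp
    ring
  have hmono := binomialMean_mono n hlog hx.1.le hx.2.le
  have hinv := mul_mul_binomialMean_inv_succ n x
  have hpow : 0 < (1 - x) ^ (n + 1) := pow_pos (sub_pos.2 hx.2) _
  calc _ ≤ ((n : ℝ) + 1) * binomialMean n (fun k => ((k : ℝ) + 1)⁻¹) x := by gcongr
    _ < x⁻¹ := by
      rw [inv_eq_one_div, lt_div_iff₀' hx.1]
      linarith

theorem binomialMean_ratio (n : ℕ) {x : ℝ} (hx1 : x < 1) :
    binomialMean n (fun k => ((k : ℝ) + 1) / (n + 1 - k)) x =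
      x / (1 - x) + (1 - ((n : ℝ) + 2) * x ^ (n + 1)) / (((n : ℝ) + 1) * (1 - x)) := by
  have hq : (1 - x) ≠ 0 := (sub_pos.2 hx1).ne'
  have hinv := mul_mul_binomialMean_inv_succ n (1 - x)
  rw [← binomialMean_reflect, sub_sub_cancel] at hinv
  have hone := sum_binomial_eq_one n x
  have key : binomialMean n (fun k => ((k : ℝ) + 1) / (n + 1 - k)) x =
      (n + 2) * binomialMean n (fun k => (((n - k : ℕ) : ℝ) + 1)⁻¹) x - 1 := by
    refine Eq.trans ?_ (congrArg _ hone)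
    rw [binomialMean, binomialMean, Finset.mul_sum, ← Finset.sum_sub_distrib]
    refine Finset.sum_congr rfl fun k hk => ?_
    have hk' : k ≤ n := Nat.lt_succ_iff.mp (Finset.mem_range.mp hk)
    have hkr : (k : ℝ) ≤ n := by exact_mod_cast hk'
    have : (n : ℝ) - k + 1 ≠ 0 := by linarith
    rw [Nat.cast_sub hk', show (n : ℝ) + 1 - k = n - k + 1 by ring]
    field_simp
    ring
  rw [key]
  generalize binomialMean n _ x = b at hinv ⊢
  field_simp
  linear_combination ((n : ℝ) + 2) * hinv

theorem binomialMean_log_ratio_lt (n : ℕ) (hn : 0 < n) {x : ℝ} (hx : 0 < x) (hx1 : x < 1) :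
    binomialMean n (fun k => Real.log (((k : ℝ) + 1) / (n + 1 - k))) x <
      Real.log (binomialMean n (fun k => ((k : ℝ) + 1) / (n + 1 - k)) x) := by
  have hq : 0 < 1 - x := sub_pos.2 hx1
  have hnr : (0 : ℝ) < n := by exact_mod_cast hn
  refine strictConcaveOn_log_Ioi.lt_map_sum (t := Finset.range (n + 1))
    (w := fun k => (Nat.choose n k : ℝ) * x ^ k * (1 - x) ^ (n - k))
    (p := fun k => ((k : ℝ) + 1) / (n + 1 - k)) (fun k hk => ?_)
    (sum_binomial_eq_one n x) (fun k hk => ?_)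
    ⟨0, by simp, n, by simp, ?_⟩
  · have := Nat.choose_pos (Nat.lt_succ_iff.mp (Finset.mem_range.mp hk))
    positivity
  · have hkr : (k : ℝ) ≤ n := by exact_mod_cast Nat.lt_succ_iff.mp (Finset.mem_range.mp hk)
    have hk0 : (0 : ℝ) < k + 1 := by positivity
    have hk1 : (0 : ℝ) < n + 1 - k := by linarith
    exact div_pos hk0 hk1
  · have h1 : ((n : ℝ) + 1) / (n + 1 - n) = n + 1 := by rw [add_sub_cancel_left, div_one]
    have h0 : (((0 : ℕ) : ℝ) + 1) / (n + 1 - (0 : ℕ)) < 1 := by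
      rw [Nat.cast_zero, div_lt_one (by linarith)]
      linarith
    refine ne_of_lt (h0.trans ?_)
    linarith

theorem log_div_lt_binomialMean (n : ℕ) (hn : 0 < n) {x : ℝ} (hx : 0 < x) (hx2 : x < 1 / 2) :
    Real.log (x / (1 - x)) <
      binomialMean n (fun k => Real.log (((k : ℝ) + 1) / (n + 1 - k))) x := by
  obtain ⟨m, rfl⟩ := Nat.exists_eq_succ_of_ne_zero hn.ne'
  have h := strictAntiOn_binomialMean_log_succ_sub_log m (a := x) (b := 1 - x)
    ⟨hx, by linarith⟩ ⟨by linarith, by linarith⟩ (by linarith)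
  have hsplit : binomialMean (m + 1)
      (fun k => Real.log (((k : ℝ) + 1) / ((m + 1 : ℕ) + 1 - k))) x =
      binomialMean (m + 1) (fun k => Real.log (k + 1)) x -
        binomialMean (m + 1) (fun k => Real.log (k + 1)) (1 - x) := by
    rw [← binomialMean_reflect]
    simp only [binomialMean, ← Finset.sum_sub_distrib]
    refine Finset.sum_congr rfl fun k hk => ?_
    have hk' : k ≤ m + 1 := Nat.lt_succ_iff.mp (Finset.mem_range.mp hk)
    have hkr : (k : ℝ) ≤ (m + 1 : ℕ) := by exact_mod_cast hk'
    rw [Real.log_div (by positivity) (by linarith), Nat.cast_sub hk', mul_sub, add_sub_right_comm]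
  rw [Real.log_div hx.ne' (by linarith), Nat.succ_eq_add_one, hsplit]
  simp only at h
  linarith

theorem stmt5 (n : ℕ) (hn : 0 < n) (x : ℝ) (hx : 0 < x) (hx2 : x < 1 / 2) :
    Real.log (x / (1 - x))
        < ∑ k ∈ Finset.range (n + 1),
            (Nat.choose n k : ℝ) * x ^ k * (1 - x) ^ (n - k)
              * Real.log ((k + 1) / ((n : ℝ) + 1 - k)) ∧
    (∑ k ∈ Finset.range (n + 1),
        (Nat.choose n k : ℝ) * x ^ k * (1 - x) ^ (n - k)
          * Real.log ((k + 1) / ((n : ℝ) + 1 - k)))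
        < Real.log (x / (1 - x)
            + (1 - ((n : ℝ) + 2) * x ^ (n + 1)) / (((n : ℝ) + 1) * (1 - x))) := by
  have hx1 : x < 1 := by linarith
  refine ⟨log_div_lt_binomialMean n hn hx hx2, ?_⟩
  rw [← binomialMean_ratio n hx1]
  exact binomialMean_log_ratio_lt n hn hx hx1
end

section
/- Let $c < 0$ and $n = -cl$ with $l \in \mathbb{N}$. Then $S_{n,c}$ is convex on $[0,-\frac{1}{c}]$. -/
/-- The basic probabilities `p_{n,k}^{[c]}(x)` for `c < 0`, `n = -c·l`:
`p_{n,k}^{[c]}(x) = C(l,k) (-cx)^k (1+cx)^{l-k}` for `k ≤ l`, and `0` for `k > l`. -/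
noncomputable def pneg (c : ℝ) (l : ℕ) (k : ℕ) (x : ℝ) : ℝ :=
  if k ≤ l then (Nat.choose l k : ℝ) * (-c * x) ^ k * (1 + c * x) ^ (l - k) else 0

/-- `S_{n,c}(x) = ∑_{k=0}^∞ (p_{n,k}^{[c]}(x))²`. -/
noncomputable def Sneg (c : ℝ) (l : ℕ) (x : ℝ) : ℝ :=
  ∑' k : ℕ, (pneg c l k x) ^ 2

/-- The average over a circle of a family of convex functions is convex. -/
theorem convexOn_circleAverage {E : Type*} [AddCommMonoid E] [Module ℝ E] {s : Set E}
    {f : E → ℂ → ℝ} {z : ℂ} {R : ℝ} (hs : Convex ℝ s)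
    (hf : ∀ w, ConvexOn ℝ s fun x ↦ f x w)
    (hint : ∀ x ∈ s, CircleIntegrable (f x) z R) :
    ConvexOn ℝ s fun x ↦ Real.circleAverage (f x) z R := by
  refine ⟨hs, fun x hx y hy a b ha hb hab ↦ ?_⟩
  have hix : CircleIntegrable (a • f x) z R := (hint x hx).const_smul
  have hiy : CircleIntegrable (b • f y) z R := (hint y hy).const_smul
  dsimp only
  rw [← Real.circleAverage_smul, ← Real.circleAverage_smul, ← Real.circleAverage_add hix hiy]
  exact Real.circleAverage_mono (hint _ (hs hx hy ha hb hab)) (hix.add hiy)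
    fun w _ ↦ (hf w).2 hx hy ha hb hab

theorem Polynomial.coeff_C_mul_X_add_C_pow {R : Type*} [CommSemiring R] (a b : R) (n k : ℕ) :
    ((C a * X + C b) ^ n).coeff k = n.choose k * a ^ k * b ^ (n - k) := by
  have h : (C a * X + C b) ^ n = ∑ m ∈ Finset.range (n + 1),
      C (a ^ m * b ^ (n - m) * n.choose m) * X ^ m := by
    rw [add_pow]
    refine Finset.sum_congr rfl fun m _ ↦ ?_
    simp only [map_mul, map_pow, map_natCast]
    ring
  rw [h, finsetSum_coeff]
  simp only [coeff_C_mul_X_pow, Finset.sum_ite_eq, Finset.mem_range]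
  split_ifs with hk
  · ring
  · rw [Nat.choose_eq_zero_of_lt (by omega)]
    simp

/-- Parseval's identity for `(a X + b) ^ l` on the unit circle, with `a = -c x` and `b = 1 + c x`. -/
theorem Sneg_eq_circleAverage (c : ℝ) (l : ℕ) (x : ℝ) :
    Sneg c l x =
      Real.circleAverage (fun w ↦ (‖1 + (x : ℂ) * (c * (1 - w))‖ ^ l) ^ 2) 0 1 := by
  set p : Polynomial ℂ := (.C ((-c * x : ℝ) : ℂ) * .X + .C ((1 + c * x : ℝ) : ℂ)) ^ l with hp
  have hcoeff (k : ℕ) : pneg c l k x ^ 2 = ‖p.coeff k‖ ^ 2 := by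
    rw [hp, Polynomial.coeff_C_mul_X_add_C_pow, pneg]
    split_ifs with hk
    · rw [← sq_abs, ← Real.norm_eq_abs, ← Complex.norm_real]
      push_cast
      rfl
    · simp [Nat.choose_eq_zero_of_lt (not_le.mp hk)]
  have heval (w : ℂ) : ‖p.eval w‖ = ‖1 + (x : ℂ) * (c * (1 - w))‖ ^ l := by
    rw [hp, Polynomial.eval_pow, norm_pow]
    congr 2
    simp
    ring
  simp_rw [← heval, ← p.sum_sq_norm_coeff_eq_circleAverage, Sneg, hcoeff]
  exact tsum_eq_sum fun k hk ↦ by simp [Polynomial.notMem_support_iff.mp hk]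

theorem convexOn_norm_affine_pow {E : Type*} [SeminormedAddCommGroup E] [NormedSpace ℝ E]
    (u v : E) (n : ℕ) : ConvexOn ℝ Set.univ fun x : ℝ ↦ ‖u + x • v‖ ^ n := by
  have h : ConvexOn ℝ Set.univ fun x : ℝ ↦ ‖u + x • v‖ := by
    refine ⟨convex_univ, fun x _ y _ a b ha hb hab ↦ ?_⟩
    have : u + (a • x + b • y) • v = a • (u + x • v) + b • (u + y • v) := by
      obtain rfl : b = 1 - a := by linarith
      module
    dsimp only
    rw [this]
    exact (convexOn_univ_norm (E := E)).2 trivial trivial ha hb hab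
  exact h.pow (fun _ _ ↦ norm_nonneg _) n

theorem stmt6 (c : ℝ) (hc : c < 0) (l : ℕ) (hl : 0 < l) :
    ConvexOn ℝ (Set.Icc 0 (-1 / c)) (Sneg c l) := by
  rw [funext (Sneg_eq_circleAverage c l)]
  refine ConvexOn.subset ?_ (Set.subset_univ _) (convex_Icc _ _)
  refine convexOn_circleAverage convex_univ (fun w ↦ ?_) fun x _ ↦
    ContinuousOn.circleIntegrable' (by fun_prop)
  simp_rw [← pow_mul, ← Complex.real_smul]
  exact convexOn_norm_affine_pow _ _ _
end

section
/- Let $c \ge 0$ and $n > c$ be real numbers. Then $y = S_{n,c}$ is a solution on $(0,+\infty)$ of the differential equation $x(1+cx)(1+2cx)\,y''(x) + \left(4(n+c)x(1+cx)+1\right) y'(x) + 2n(1+2cx)\,y(x) = 0$. -/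
/-- `S_{n,c}(x) = ∑_{k=0}^∞ (p_{n,k}^{[c]}(x))²`. -/
noncomputable def Sc (c n : ℝ) (x : ℝ) : ℝ :=
  ∑' k : ℕ, (pc c n k x) ^ 2

open Filter Topology in
theorem summable_natCast_mul_pow_pred {a : ℕ → ℝ} {s r : ℝ} (hs : 0 < s) (hsr : s < r)
    (ha : Summable fun k => |a k| * r ^ k) :
    Summable fun k : ℕ => |a k| * (k * s ^ (k - 1)) := by
  have hr : 0 < r := hs.trans hsr
  have hq : ‖s / r‖ < 1 := by
    rw [Real.norm_of_nonneg (by positivity), div_lt_one hr]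
    exact hsr
  have hg := (summable_pow_mul_geometric_of_norm_lt_one 1 hq).tendsto_atTop_zero
  have hev : ∀ᶠ k : ℕ in atTop, (k : ℝ) ^ 1 * (s / r) ^ k < 1 := hg.eventually_lt_const one_pos
  refine summable_of_isBigO_nat ha (Asymptotics.IsBigO.of_bound s⁻¹ ?_)
  filter_upwards [hev] with k hk
  rw [Real.norm_of_nonneg (by positivity), Real.norm_of_nonneg (by positivity)]
  rcases k with _ | k
  · simp; positivity
  · rw [pow_one, div_pow, mul_div_assoc', div_lt_one (by positivity)] at hk
    have h : ((k + 1 : ℕ) : ℝ) * s ^ (k + 1 - 1) ≤ s⁻¹ * r ^ (k + 1) := by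
      rw [inv_mul_eq_div, le_div_iff₀ hs, Nat.add_sub_cancel, mul_assoc, ← pow_succ]
      exact hk.le
    calc _ ≤ |a (k + 1)| * (s⁻¹ * r ^ (k + 1)) := by gcongr
      _ = _ := by ring

theorem hasDerivAt_tsum_mul_pow {a : ℕ → ℝ} {r x : ℝ} (hx : |x| < r)
    (ha : Summable fun k => |a k| * r ^ k) :
    HasDerivAt (fun y => ∑' k, a k * y ^ k) (∑' k : ℕ, a k * (k * x ^ (k - 1))) x := by
  obtain ⟨s, hxs, hsr⟩ := exists_between hx
  have hs : 0 < s := (abs_nonneg x).trans_lt hxs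
  refine hasDerivAt_tsum_of_isPreconnected (g := fun k y => a k * y ^ k)
    (g' := fun k y => a k * (k * y ^ (k - 1))) (t := Set.Ioo (-s) s) (y₀ := 0)
    (summable_natCast_mul_pow_pred hs hsr ha) isOpen_Ioo isPreconnected_Ioo
    (fun k y _ => (hasDerivAt_pow k y).const_mul _) (fun k y hy => ?_) ⟨by linarith, hs⟩ ?_
    (abs_lt.mp hxs)
  · have hy' : |y| ≤ s := (abs_lt.mpr hy).le
    simp only [norm_mul, Real.norm_eq_abs, abs_pow, Nat.abs_cast]
    gcongr
  · exact summable_of_ne_finset_zero (s := {0}) fun k hk => by simp_all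

/-- The coefficients `(n (n + c) ⋯ (n + (k - 1) c) / k!)²`. -/
noncomputable def sqCoeff (c n : ℝ) (k : ℕ) : ℝ :=
  ((∏ i ∈ Finset.range k, (n + c * i)) / (Nat.factorial k)) ^ 2

theorem sqCoeff_succ (c n : ℝ) (k : ℕ) :
    sqCoeff c n (k + 1) = ((n + c * k) / (k + 1)) ^ 2 * sqCoeff c n k := by
  have : (Nat.factorial k : ℝ) ≠ 0 := by positivity
  simp only [sqCoeff, Finset.prod_range_succ, Nat.factorial_succ]
  push_cast
  field_simp

theorem sqCoeff_pos {c n : ℝ} (hc : 0 ≤ c) (hn : 0 < n) (k : ℕ) : 0 < sqCoeff c n k := by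
  have : 0 < ∏ i ∈ Finset.range k, (n + c * i) := Finset.prod_pos fun i _ => by positivity
  unfold sqCoeff
  positivity

open Filter Topology in
theorem summable_sqCoeff_mul_pow {c n r : ℝ} (hc : 0 ≤ c) (hn : 0 < n) (hr : 0 < r)
    (hcr : c ^ 2 * r < 1) : Summable fun k => |sqCoeff c n k| * r ^ k := by
  have hlim : Tendsto (fun k : ℕ => ((n + c * k) / (k + 1)) ^ 2 * r) atTop (𝓝 (c ^ 2 * r)) := by
    have h : Tendsto (fun k : ℕ => c + (n - c) * (1 / ((k : ℝ) + 1))) atTop (𝓝 c) := by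
      simpa using (tendsto_one_div_add_atTop_nhds_zero_nat (𝕜 := ℝ)).const_mul (n - c)
        |>.const_add c
    refine ((h.pow 2).mul_const r).congr fun k => ?_
    congr 2
    field_simp
    ring
  refine summable_of_ratio_test_tendsto_lt_one hcr
    (Eventually.of_forall fun k => ?_) (hlim.congr fun k => ?_)
  · have := sqCoeff_pos hc hn k
    positivity
  · have hk := sqCoeff_pos hc hn k
    have hk' := sqCoeff_pos hc hn (k + 1)
    rw [Real.norm_of_nonneg (by positivity), Real.norm_of_nonneg (by positivity),
      abs_of_pos hk, abs_of_pos hk', sqCoeff_succ]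
    field_simp
    ring

theorem exists_gt_mul_lt_one_s8 {a r : ℝ} (h : a * r < 1) : ∃ s, r < s ∧ a * s < 1 := by
  have hev : ∀ᶠ s in nhdsWithin r (Set.Ioi r), a * s < 1 :=
    (by fun_prop : ContinuousWithinAt (fun s => a * s) (Set.Ioi r) r).eventually_lt_const h
  exact (hev.and self_mem_nhdsWithin).exists.imp fun s hs => ⟨hs.2, hs.1⟩

theorem summable_natCast_mul_sqCoeff_mul_pow {c n r : ℝ} (hc : 0 ≤ c) (hn : 0 < n) (hr : 0 < r)
    (hcr : c ^ 2 * r < 1) : Summable fun k : ℕ => |k * sqCoeff c n k| * r ^ k := by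
  obtain ⟨s, hrs, hs⟩ : ∃ s, r < s ∧ c ^ 2 * s < 1 := by
    have h : ∀ᶠ s in nhdsWithin r (Set.Ioi r), c ^ 2 * s < 1 :=
      ((continuous_const.mul continuous_id).continuousWithinAt.eventually_lt
        continuousWithinAt_const hcr)
    exact (h.and self_mem_nhdsWithin).exists.imp fun s hs => ⟨hs.2, hs.1⟩
  refine ((summable_natCast_mul_pow_pred hr hrs
    (summable_sqCoeff_mul_pow hc hn (hr.trans hrs) hs)).mul_right r).congr fun k => ?_
  rcases k with _ | k
  · simp
  · rw [abs_mul, Nat.abs_cast, Nat.add_sub_cancel, pow_succ]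
    ring

/-- The power series with coefficients `sqCoeff c n`. -/
noncomputable def sqSeries (c n u : ℝ) : ℝ := ∑' k, sqCoeff c n k * u ^ k

/-- The Euler derivative `u ↦ u F'(u)` of `F = sqSeries c n`. -/
noncomputable def sqSeriesEuler (c n u : ℝ) : ℝ := ∑' k : ℕ, k * sqCoeff c n k * u ^ k

theorem hasDerivAt_sqSeries {c n u : ℝ} (hc : 0 ≤ c) (hn : 0 < n) (hu : 0 < u)
    (hcu : c ^ 2 * u < 1) :
    HasDerivAt (sqSeries c n) (sqSeriesEuler c n u / u) u := by
  obtain ⟨s, hus, hs⟩ : ∃ s, u < s ∧ c ^ 2 * s < 1 := by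
    have h : ∀ᶠ s in nhdsWithin u (Set.Ioi u), c ^ 2 * s < 1 :=
      ((continuous_const.mul continuous_id).continuousWithinAt.eventually_lt
        continuousWithinAt_const hcu)
    exact (h.and self_mem_nhdsWithin).exists.imp fun s hs => ⟨hs.2, hs.1⟩
  refine (hasDerivAt_tsum_mul_pow (by rwa [abs_of_pos hu])
    (summable_sqCoeff_mul_pow hc hn (hu.trans hus) hs)).congr_deriv ?_
  rw [sqSeriesEuler, ← tsum_div_const]
  refine tsum_congr fun k => ?_
  rcases k with _ | k
  · simp
  · rw [Nat.add_sub_cancel]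
    field_simp
    ring

/-- The hypergeometric differential equation for `sqSeries`, in terms of its Euler derivative. -/
theorem hasDerivAt_sqSeriesEuler {c n u : ℝ} (hc : 0 ≤ c) (hn : 0 < n) (hu : 0 < u)
    (hcu : c ^ 2 * u < 1) :
    HasDerivAt (sqSeriesEuler c n)
      ((n ^ 2 * sqSeries c n u + 2 * n * c * sqSeriesEuler c n u) / (1 - c ^ 2 * u)) u := by
  obtain ⟨s, hus, hs⟩ : ∃ s, u < s ∧ c ^ 2 * s < 1 := by
    have h : ∀ᶠ s in nhdsWithin u (Set.Ioi u), c ^ 2 * s < 1 :=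
      ((continuous_const.mul continuous_id).continuousWithinAt.eventually_lt
        continuousWithinAt_const hcu)
    exact (h.and self_mem_nhdsWithin).exists.imp fun s hs => ⟨hs.2, hs.1⟩
  have hsum := summable_natCast_mul_sqCoeff_mul_pow hc hn (hu.trans hus) hs
  refine (hasDerivAt_tsum_mul_pow (by rwa [abs_of_pos hu]) hsum).congr_deriv ?_
  rw [eq_div_iff (by linarith)]
  have h₀ : Summable fun k : ℕ => sqCoeff c n k * u ^ k :=
    (summable_sqCoeff_mul_pow hc hn hu hcu).congr fun k => by
      rw [abs_of_pos (sqCoeff_pos hc hn k)]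
  have h₁ : Summable fun k : ℕ => k * sqCoeff c n k * u ^ k :=
    (summable_natCast_mul_sqCoeff_mul_pow hc hn hu hcu).congr fun k => by
      rw [abs_of_nonneg (mul_nonneg k.cast_nonneg (sqCoeff_pos hc hn k).le)]
  have h₂ : Summable fun k : ℕ => k * sqCoeff c n k * (k * u ^ (k - 1)) :=
    (summable_natCast_mul_pow_pred hu hus hsum).congr fun k => by
      rw [abs_of_nonneg (mul_nonneg k.cast_nonneg (sqCoeff_pos hc hn k).le)]
  have key : ∑' k : ℕ, k * sqCoeff c n k * (k * u ^ (k - 1))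
      = n ^ 2 * sqSeries c n u + 2 * n * c * sqSeriesEuler c n u
        + c ^ 2 * u * ∑' k : ℕ, k * sqCoeff c n k * (k * u ^ (k - 1)) := by
    rw [sqSeries, sqSeriesEuler, ← tsum_mul_left, ← tsum_mul_left, ← tsum_mul_left,
      ← (h₀.mul_left _).tsum_add (h₁.mul_left _),
      ← ((h₀.mul_left _).add (h₁.mul_left _)).tsum_add (h₂.mul_left _),
      h₂.tsum_eq_zero_add]
    simp only [Nat.cast_zero, zero_mul, zero_add]
    refine tsum_congr fun k => ?_
    rw [sqCoeff_succ]
    have hk : c ^ 2 * u * (k * sqCoeff c n k * (k * u ^ (k - 1)))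
        = c ^ 2 * k ^ 2 * sqCoeff c n k * u ^ k := by
      rcases k with _ | k
      · simp
      · rw [Nat.add_sub_cancel]; ring
    rw [hk, Nat.add_sub_cancel]
    push_cast
    field_simp
    ring
  linear_combination key

/-- The square of the factor `p_{n,0}^{[c]}`. -/
noncomputable def sqWeight (c n x : ℝ) : ℝ := (pc c n 0 x) ^ 2

theorem pc_zero {c n x : ℝ} : pc c n 0 x =
    if c = 0 then Real.exp (-(n * x)) else (1 + c * x) ^ (-n / c) := by
  simp [pc, genBinom]

theorem hasDerivAt_sqWeight {c n x : ℝ} (hc : 0 ≤ c) (hx : 0 < x) :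
    HasDerivAt (sqWeight c n) (-2 * n / (1 + c * x) * sqWeight c n x) x := by
  have h₁ : 0 < 1 + c * x := by positivity
  have hp : HasDerivAt (pc c n 0) (-n / (1 + c * x) * pc c n 0 x) x := by
    rw [funext fun y => pc_zero (c := c) (n := n) (x := y)]
    split_ifs with h
    · subst h
      refine (((hasDerivAt_id x).const_mul n).fun_neg.exp).congr_deriv ?_
      simp; ring
    · refine ((((hasDerivAt_id x).const_mul c).const_add 1).rpow_const
        (p := -n / c) (Or.inl h₁.ne')).congr_deriv ?_
      simp only [id]
      rw [Real.rpow_sub_one h₁.ne']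
      field_simp
  refine (hp.fun_pow 2).congr_deriv ?_
  rw [sqWeight]
  field_simp
  norm_num
  ring

theorem pc_sq {c n x : ℝ} (hc : 0 ≤ c) (hx : 0 < x) (k : ℕ) :
    pc c n k x ^ 2 = sqWeight c n x * (sqCoeff c n k * ((x / (1 + c * x)) ^ 2) ^ k) := by
  have h₁ : 0 < 1 + c * x := by positivity
  have hp : pc c n k x = pc c n 0 x *
      ((∏ i ∈ Finset.range k, (n + c * i)) / (Nat.factorial k) * (x / (1 + c * x)) ^ k) := by
    rw [pc_zero, pc]
    split_ifs with h
    · subst h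
      simp [mul_pow]
      ring
    · have hprod : ∏ i ∈ Finset.range k, (n + c * i)
          = (-1) ^ k * (∏ i ∈ Finset.range k, (-n / c - i)) * c ^ k := by
        induction k with
        | zero => simp
        | succ k ih =>
          rw [Finset.prod_range_succ, Finset.prod_range_succ, ih]
          field_simp
          ring
      rw [hprod, genBinom, Real.rpow_sub_natCast h₁.ne', mul_pow, div_pow]
      field_simp
  rw [hp, sqWeight, sqCoeff]
  ring

theorem Sc_eq {c n x : ℝ} (hc : 0 ≤ c) (hx : 0 < x) :
    Sc c n x = sqWeight c n x * sqSeries c n ((x / (1 + c * x)) ^ 2) := by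
  rw [Sc, sqSeries, ← tsum_mul_left]
  exact tsum_congr fun k => pc_sq hc hx k

theorem hasDerivAt_div_one_add_sq {c x : ℝ} (h₁ : 1 + c * x ≠ 0) :
    HasDerivAt (fun y : ℝ => (y / (1 + c * y)) ^ 2) (2 * x / (1 + c * x) ^ 3) x := by
  have h := ((hasDerivAt_id x).fun_div (((hasDerivAt_id x).const_mul c).const_add 1) h₁).fun_pow 2
  refine h.congr_deriv ?_
  norm_num
  field_simp
  ring

theorem sq_mul_div_one_add_sq_lt_one {c x : ℝ} (hc : 0 ≤ c) (hx : 0 < x) :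
    c ^ 2 * (x / (1 + c * x)) ^ 2 < 1 := by
  have h₁ : 0 < 1 + c * x := by positivity
  have : 0 ≤ c * x := by positivity
  rw [div_pow, mul_div_assoc', div_lt_one (by positivity)]
  nlinarith

/-- The derivative of `S_{n,c}` at `x`. -/
noncomputable def ScDeriv (c n x : ℝ) : ℝ :=
  sqWeight c n x * (-2 * n / (1 + c * x) * sqSeries c n ((x / (1 + c * x)) ^ 2)
    + 2 / (x * (1 + c * x)) * sqSeriesEuler c n ((x / (1 + c * x)) ^ 2))

theorem hasDerivAt_Sc {c n x : ℝ} (hc : 0 ≤ c) (hn : 0 < n) (hx : 0 < x) :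
    HasDerivAt (Sc c n) (ScDeriv c n x) x := by
  have h₁ : 0 < 1 + c * x := by positivity
  have hF := (hasDerivAt_sqSeries hc hn (by positivity)
    (sq_mul_div_one_add_sq_lt_one hc hx)).comp x (hasDerivAt_div_one_add_sq h₁.ne')
  refine (((hasDerivAt_sqWeight (n := n) hc hx).mul hF).congr_deriv ?_).congr_of_eventuallyEq ?_
  · simp only [ScDeriv, Function.comp]
    field_simp
  · filter_upwards [Ioi_mem_nhds hx] with y hy using Sc_eq hc hy

theorem hasDerivAt_ScDeriv {c n x : ℝ} (hc : 0 ≤ c) (hn : 0 < n) (hx : 0 < x) :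
    HasDerivAt (ScDeriv c n)
      (-((4 * (n + c) * x * (1 + c * x) + 1) * ScDeriv c n x
        + 2 * n * (1 + 2 * c * x) * Sc c n x) / (x * (1 + c * x) * (1 + 2 * c * x))) x := by
  have h₁ : 0 < 1 + c * x := by positivity
  have h₂ : 0 < 1 + 2 * c * x := by positivity
  have hu := sq_mul_div_one_add_sq_lt_one hc hx
  have hF := (hasDerivAt_sqSeries hc hn (by positivity) hu).comp x
    (hasDerivAt_div_one_add_sq h₁.ne')
  have hG := (hasDerivAt_sqSeriesEuler hc hn (by positivity) hu).comp x
    (hasDerivAt_div_one_add_sq h₁.ne')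
  have hl : HasDerivAt (fun y : ℝ => 1 + c * y) c x := by
    simpa using ((hasDerivAt_id x).const_mul c).const_add 1
  have hA := (hasDerivAt_const x (-2 * n)).fun_div hl h₁.ne'
  have hB := (hasDerivAt_const x (2 : ℝ)).fun_div ((hasDerivAt_id x).fun_mul hl)
    (mul_pos hx h₁).ne'
  have hden : 1 - c ^ 2 * (x / (1 + c * x)) ^ 2 = (1 + 2 * c * x) / (1 + c * x) ^ 2 := by
    field_simp
    ring
  refine ((hasDerivAt_sqWeight (n := n) hc hx).fun_mul ((hA.fun_mul hF).fun_add
    (hB.fun_mul hG))).congr_deriv ?_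
  rw [Sc_eq hc hx, ScDeriv, hden]
  simp only [Function.comp, id]
  generalize sqSeries c n _ = F
  generalize sqSeriesEuler c n _ = G
  field_simp
  ring

theorem stmt8 (c n : ℝ) (hc : 0 ≤ c) (hn : c < n) :
    ∀ x ∈ Set.Ioi (0 : ℝ),
      x * (1 + c * x) * (1 + 2 * c * x) * iteratedDeriv 2 (Sc c n) x
        + (4 * (n + c) * x * (1 + c * x) + 1) * deriv (Sc c n) x
        + 2 * n * (1 + 2 * c * x) * Sc c n x = 0 := by
  intro x hx
  have hx : 0 < x := hx
  have hn : 0 < n := hc.trans_lt hn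
  have hderiv : deriv (Sc c n) =ᶠ[nhds x] ScDeriv c n := by
    filter_upwards [Ioi_mem_nhds hx] with y hy using (hasDerivAt_Sc hc hn hy).deriv
  rw [iteratedDeriv_succ, iteratedDeriv_one, hderiv.deriv_eq,
    (hasDerivAt_ScDeriv hc hn hx).deriv, hderiv.eq_of_nhds]
  field_simp
  ring
end

section
/- Let $c < 0$ and $n = -cl$ with $l \in \mathbb{N}$. Then $y = S_{n,c}$ is a solution on $(0,-\frac{1}{c})$ of the differential equation $x(1+cx)(1+2cx)\,y''(x) + \left(4(n+c)x(1+cx)+1\right) y'(x) + 2n(1+2cx)\,y(x) = 0$. -/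
theorem HasDerivAt.pow_mul_div {f : ℝ → ℝ} {f' x : ℝ} (hf : HasDerivAt f f' x) (hx : f x ≠ 0)
    (m : ℕ) : HasDerivAt (fun y => f y ^ m) (f x ^ m * (m * f' / f x)) x := by
  refine (hf.fun_pow m).congr_deriv ?_
  cases m with
  | zero => simp
  | succ m =>
    rw [Nat.add_sub_cancel, pow_succ]
    field_simp

theorem hasDerivAt_one_add_mul (c x : ℝ) : HasDerivAt (fun y => 1 + c * y) c x := by
  simpa using ((hasDerivAt_id x).const_mul c).const_add 1

/-- The logarithmic derivative of `p_{n,k}^{[c]}`. -/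
noncomputable def pnegLogDeriv (c : ℝ) (l k : ℕ) (x : ℝ) : ℝ :=
  k / x + (l - k) * c / (1 + c * x)

theorem hasDerivAt_pneg {c x : ℝ} (hc : c ≠ 0) (hx : x ≠ 0) (hx' : 1 + c * x ≠ 0) (l k : ℕ) :
    HasDerivAt (pneg c l k) (pneg c l k x * pnegLogDeriv c l k x) x := by
  unfold pneg pnegLogDeriv
  split_ifs with h
  · have h₁ : HasDerivAt (fun y => -c * y) (-c) x := by
      simpa using (hasDerivAt_id x).const_mul (-c)
    have h₂ := h₁.pow_mul_div (mul_ne_zero (neg_ne_zero.mpr hc) hx) k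
    have h₃ := (hasDerivAt_one_add_mul c x).pow_mul_div hx' (l - k)
    refine ((h₂.const_mul (Nat.choose l k : ℝ)).fun_mul h₃).congr_deriv ?_
    rw [Nat.cast_sub h]
    field_simp
  · simpa using hasDerivAt_const x (0 : ℝ)

theorem hasDerivAt_pnegLogDeriv {c x : ℝ} (hx : x ≠ 0) (hx' : 1 + c * x ≠ 0) (l k : ℕ) :
    HasDerivAt (pnegLogDeriv c l k) (-k / x ^ 2 - (l - k) * c ^ 2 / (1 + c * x) ^ 2) x := by
  unfold pnegLogDeriv
  refine (((hasDerivAt_const x (k : ℝ)).fun_div (hasDerivAt_id' x) hx).fun_add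
    ((hasDerivAt_const x ((l - k : ℝ) * c)).fun_div
      (hasDerivAt_one_add_mul c x) hx')).congr_deriv ?_
  ring

theorem pneg_succ_mul (c x : ℝ) (l k : ℕ) :
    (k + 1) * pneg c l (k + 1) x * (1 + c * x) = (l - k) * (-c * x) * pneg c l k x := by
  unfold pneg
  rcases lt_trichotomy k l with h | rfl | h
  · rw [if_pos (Nat.succ_le_of_lt h), if_pos h.le]
    have hch : (Nat.choose l (k + 1) : ℝ) * (k + 1) = Nat.choose l k * (l - k) := by
      rw [← Nat.cast_sub h.le]
      exact_mod_cast Nat.choose_succ_right_eq l k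
    rw [show l - k = l - (k + 1) + 1 by omega, pow_succ, pow_succ]
    linear_combination (-c * x) ^ k * (-c * x) * (1 + c * x) ^ (l - (k + 1)) * (1 + c * x) * hch
  · simp
  · rw [if_neg (by omega), if_neg (by omega)]
    simp

theorem Sneg_eq_sum (c : ℝ) (l : ℕ) (x : ℝ) :
    Sneg c l x = ∑ k ∈ Finset.range (l + 1), pneg c l k x ^ 2 := by
  refine tsum_eq_sum fun k hk => ?_
  have : ¬ k ≤ l := by simpa [Nat.lt_succ_iff] using hk
  simp [pneg, this]

theorem hasDerivAt_Sneg {c x : ℝ} (hc : c ≠ 0) (hx : x ≠ 0) (hx' : 1 + c * x ≠ 0) (l : ℕ) :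
    HasDerivAt (Sneg c l)
      (∑ k ∈ Finset.range (l + 1), pneg c l k x ^ 2 * (2 * pnegLogDeriv c l k x)) x := by
  rw [funext (Sneg_eq_sum c l)]
  refine HasDerivAt.fun_sum fun k _ => ?_
  refine ((hasDerivAt_pneg hc hx hx' l k).fun_pow 2).congr_deriv ?_
  push_cast
  ring

theorem iteratedDeriv_two_Sneg {c x : ℝ} (hc : c ≠ 0) (hx : x ≠ 0) (hx' : 1 + c * x ≠ 0)
    (l : ℕ) :
    iteratedDeriv 2 (Sneg c l) x = ∑ k ∈ Finset.range (l + 1), pneg c l k x ^ 2 *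
      (4 * pnegLogDeriv c l k x ^ 2
        + 2 * (-k / x ^ 2 - (l - k) * c ^ 2 / (1 + c * x) ^ 2)) := by
  have hev : deriv (Sneg c l) =ᶠ[nhds x] fun y =>
      ∑ k ∈ Finset.range (l + 1), pneg c l k y ^ 2 * (2 * pnegLogDeriv c l k y) := by
    filter_upwards [isOpen_ne.mem_nhds hx,
      (hasDerivAt_one_add_mul c x).continuousAt.eventually_ne hx'] with y hy hy'
    exact (hasDerivAt_Sneg hc hy hy' l).deriv
  rw [iteratedDeriv_succ, iteratedDeriv_one, hev.deriv_eq]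
  refine HasDerivAt.deriv (HasDerivAt.fun_sum fun k _ => ?_)
  refine (((hasDerivAt_pneg hc hx hx' l k).fun_pow 2).fun_mul
    ((hasDerivAt_pnegLogDeriv hx hx' l k).const_mul 2)).congr_deriv ?_
  push_cast
  ring

theorem stmt9 (c : ℝ) (hc : c < 0) (l : ℕ) (hl : 0 < l) (n : ℝ) (hn : n = -c * l) :
    ∀ x ∈ Set.Ioo (0 : ℝ) (-1 / c),
      x * (1 + c * x) * (1 + 2 * c * x) * iteratedDeriv 2 (Sneg c l) x
        + (4 * (n + c) * x * (1 + c * x) + 1) * deriv (Sneg c l) x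
        + 2 * n * (1 + 2 * c * x) * Sneg c l x = 0 := by
  intro x hx
  have hx₀ : x ≠ 0 := hx.1.ne'
  have hx₁ : 1 + c * x ≠ 0 := by
    have := (lt_div_iff_of_neg hc).mp hx.2
    intro h
    linarith
  rw [iteratedDeriv_two_Sneg hc.ne hx₀ hx₁, (hasDerivAt_Sneg hc.ne hx₀ hx₁ l).deriv,
    Sneg_eq_sum, Finset.mul_sum, Finset.mul_sum, Finset.mul_sum, ← Finset.sum_add_distrib,
    ← Finset.sum_add_distrib]
  set G : ℕ → ℝ := fun k => 4 * (1 + c * x) / x * (k * pneg c l k x) ^ 2 with hG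
  trans ∑ k ∈ Finset.range (l + 1), (G k - G (k + 1))
  · refine Finset.sum_congr rfl fun k _ => ?_
    have hsucc : ((k + 1 : ℕ) : ℝ) * pneg c l (k + 1) x
        = (l - k) * (-c * x) * pneg c l k x / (1 + c * x) := by
      rw [eq_div_iff hx₁, ← pneg_succ_mul]
      push_cast
      ring
    simp only [hG, hsucc, pnegLogDeriv, hn]
    generalize pneg c l k x = p
    obtain ⟨b, hb⟩ : ∃ b, 1 + c * x = b := ⟨_, rfl⟩
    have hcb : c = (b - 1) / x := by
      rw [eq_div_iff hx₀]
      linarith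
    rw [hb] at hx₁ ⊢
    rw [hcb]
    field_simp
    ring
  · rw [Finset.sum_range_sub']
    simp [hG, pneg]
end
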